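/- arXiv:2504.06989 — 4 statements merged into one kernel-verified Lean document; each statement's English description precedes it below -/
import Mathlib

section
/- Let γ > 0. There is r0 ∈ (0,1) such that for every r ∈ (0,r0), the contour integral q1(t) defined in the context satisfies lim_{t→∞} q1(t)/√t = 1/√(2πγ). -/
open Filter

/-- `∮_{|z|=ρ} f(z) dz/(2πiz)`: the normalized contour integral over the counterclockwise
circle of radius `ρ` centered at the origin. -/
noncomputable def cint (ρ : ℝ) (f : ℂ → ℂ) : ℂ :=
  (2 * Real.pi * Complex.I)⁻¹ * (∮ z in C(0, ρ), f z / z)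

/-- `c(z) = (z + 1/z)/2`. -/
noncomputable def cfun (z : ℂ) : ℂ := (z + z⁻¹) / 2

/-- `ε_γ(z) = -z + 1/z - 2γ`. -/
noncomputable def epsfun (γ : ℂ) (z : ℂ) : ℂ := -z + z⁻¹ - 2 * γ

/-- The contour-integral expression for `q1(t)`. -/
noncomputable def q1 (γ r : ℝ) (t : ℝ) : ℂ :=
  cint r fun z1 => cint 1 fun z2 =>
    Complex.exp (t * (epsfun γ z1 + epsfun γ z2)) *
      ((cfun z1 - cfun z2) / (cfun z1 - cfun z2 - 2 * γ)) *
      (z1 * z2 / (1 - z1 * z2) ^ 2)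

section CircleAverages

open Real MeasureTheory Metric

theorem cint_eq_circleAverage {ρ : ℝ} (hρ : ρ ≠ 0) (f : ℂ → ℂ) :
    cint ρ f = circleAverage f 0 ρ := by
  rw [circleAverage_eq_circleIntegral hρ, cint]
  simp [div_eq_inv_mul]

theorem circleAverage_eq_of_differentiableAt {f : ℂ → ℂ} {r R : ℝ} (hr : 0 < r) (hR : 0 < R)
    (hf : ∀ z, z ≠ 0 → DifferentiableAt ℂ f z) :
    circleAverage f 0 r = circleAverage f 0 R := by
  wlog h : r ≤ R generalizing r R
  · exact (this hR hr (le_of_not_ge h)).symm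
  have hne : ∀ z ∈ closedBall (0 : ℂ) R \ ball 0 r, z ≠ 0 := by
    rintro z hz rfl
    exact hz.2 (mem_ball_self hr)
  rw [circleAverage_eq_circleIntegral hr.ne', circleAverage_eq_circleIntegral hR.ne',
    Complex.circleIntegral_sub_center_inv_smul_eq_of_differentiable_on_annulus_off_countable hr h
      Set.countable_empty (fun z hz => (hf z (hne z hz)).continuousAt.continuousWithinAt)]
  rintro z ⟨⟨hz, hz'⟩, -⟩
  exact hf z (hne z ⟨ball_subset_closedBall hz, fun h => hz' (ball_subset_closedBall h)⟩)

theorem circleAverage_comp_mul_left (f : ℂ → ℂ) (c : ℂ) (R : ℝ) :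
    circleAverage (fun z => f (c * z)) 0 R = circleAverage f 0 (‖c‖ * R) := by
  rw [circleAverage_eq_integral_add (f := f) c.arg, circleAverage_def]
  congr 2 with θ
  congr 1
  conv_lhs => rw [← Complex.norm_mul_exp_arg_mul_I c]
  simp only [circleMap, zero_add, Complex.ofReal_mul, Complex.ofReal_add, add_mul, Complex.exp_add]
  ring

theorem integral_integral_swap_of_continuous {E : Type*} [NormedAddCommGroup E] [NormedSpace ℝ E]
    {f : ℝ → ℝ → E} (hf : Continuous (Function.uncurry f)) (a b c d : ℝ) :
    ∫ x in a..b, ∫ y in c..d, f x y = ∫ y in c..d, ∫ x in a..b, f x y := by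
  simp only [intervalIntegral.intervalIntegral_eq_integral_uIoc, integral_smul]
  rw [smul_comm, integral_integral_swap]
  rw [Measure.prod_restrict, ← integrableOn_univ, IntegrableOn, Measure.restrict_univ]
  exact (hf.continuousOn.integrableOn_compact (isCompact_uIcc.prod isCompact_uIcc)).mono_set
    (Set.prod_mono Set.uIoc_subset_uIcc Set.uIoc_subset_uIcc)

theorem circleAverage_circleAverage_swap {f : ℂ → ℂ → ℂ} {r R : ℝ}
    (hf : Continuous fun p : ℝ × ℝ => f (circleMap 0 r p.1) (circleMap 0 R p.2)) :
    circleAverage (fun z => circleAverage (fun w => f z w) 0 R) 0 r =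
      circleAverage (fun w => circleAverage (fun z => f z w) 0 r) 0 R := by
  simp only [circleAverage_def, intervalIntegral.integral_smul]
  rw [integral_integral_swap_of_continuous
    (f := fun x y => f (circleMap 0 r x) (circleMap 0 R y)) hf]

/-- The entire function `∑ ζ ^ j / (j !) ^ 2`, given by its contour integral. -/
noncomputable def besselGen (ζ : ℂ) : ℂ :=
  circleAverage (fun z => Complex.exp (z + ζ / z)) 0 1

theorem circleAverage_exp_mul_add_div {p : ℂ} (hp : p ≠ 0) (q : ℂ) {ρ : ℝ} (hρ : 0 < ρ) :
    circleAverage (fun z => Complex.exp (p * z + q / z)) 0 ρ = besselGen (p * q) := by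
  have h := circleAverage_comp_mul_left (fun w => Complex.exp (w + p * q / w)) p ρ
  rw [besselGen, ← circleAverage_eq_of_differentiableAt (mul_pos (norm_pos_iff.2 hp) hρ) one_pos,
    ← h]
  · simp only [mul_div_mul_left _ _ hp]
  · intro z hz
    fun_prop (disch := assumption)

theorem besselGen_zero : besselGen 0 = 1 := by
  have : DiffContOnCl ℂ Complex.exp (ball 0 |1|) := Complex.differentiable_exp.diffContOnCl
  simpa [besselGen] using this.circleAverage

theorem differentiable_besselGen : Differentiable ℂ besselGen := by
  intro ζ₀
  have hne : ∀ θ : ℝ, circleMap 0 1 θ ≠ 0 := fun θ => circleMap_ne_center one_ne_zero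
  have hn : ∀ θ : ℝ, ‖circleMap 0 1 θ‖ = 1 := fun θ => by simp
  have key := (intervalIntegral.hasDerivAt_integral_of_dominated_loc_of_deriv_le
    (μ := volume) (a := 0) (b := 2 * π) (x₀ := ζ₀) (s := ball ζ₀ 1)
    (F := fun ζ θ => Complex.exp (circleMap 0 1 θ + ζ / circleMap 0 1 θ))
    (F' := fun ζ θ => Complex.exp (circleMap 0 1 θ + ζ / circleMap 0 1 θ) * (circleMap 0 1 θ)⁻¹)
    (bound := fun _ => Real.exp (2 + ‖ζ₀‖)) (ball_mem_nhds _ one_pos) ?_ ?_ ?_ ?_ ?_ ?_).2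
  · have := key.differentiableAt.const_smul ((2 * π)⁻¹ : ℝ)
    exact this
  · refine Eventually.of_forall fun ζ => Continuous.aestronglyMeasurable ?_
    fun_prop (disch := intro θ; exact hne θ)
  · refine Continuous.intervalIntegrable ?_ _ _
    fun_prop (disch := intro θ; exact hne θ)
  · refine Continuous.aestronglyMeasurable ?_
    fun_prop (disch := intro θ; exact hne θ)
  · refine Eventually.of_forall fun θ _ ζ hζ => ?_
    rw [norm_mul, norm_inv, hn, inv_one, mul_one, Complex.norm_exp]
    refine Real.exp_le_exp.2 ((Complex.re_le_norm _).trans ((norm_add_le _ _).trans ?_))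
    rw [norm_div, hn, div_one]
    have h1 : ‖ζ‖ ≤ ‖ζ₀‖ + ‖ζ - ζ₀‖ := norm_le_norm_add_norm_sub' ζ ζ₀
    have h2 : ‖ζ - ζ₀‖ < 1 := by simpa [dist_eq_norm] using hζ
    linarith
  · simp
  · refine Eventually.of_forall fun θ _ ζ _ => ?_
    have := (((hasDerivAt_id ζ).div_const (circleMap 0 1 θ)).const_add (circleMap 0 1 θ)).cexp
    simpa using this

/-- The entire function `(besselGen ζ - 1) / ζ`. -/
noncomputable def besselSlope : ℂ → ℂ := dslope besselGen 0

theorem differentiable_besselSlope : Differentiable ℂ besselSlope := by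
  rw [← differentiableOn_univ, besselSlope, Complex.differentiableOn_dslope Filter.univ_mem]
  exact differentiable_besselGen.differentiableOn

theorem mul_besselSlope (ζ : ℂ) : ζ * besselSlope ζ = besselGen ζ - 1 := by
  have := sub_smul_dslope besselGen 0 ζ
  simpa [besselGen_zero, besselSlope] using this

theorem circleAverage_div_one_sub_sq {r : ℝ} (hr : 0 < r) (hr1 : r < 1) :
    circleAverage (fun u : ℂ => u / (1 - u) ^ 2) 0 r = 0 := by
  have hd : DifferentiableOn ℂ (fun u : ℂ => u / (1 - u) ^ 2) (closedBall 0 r) := by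
    intro u hu
    have : (1 - u) ^ 2 ≠ 0 := by
      refine pow_ne_zero 2 (sub_ne_zero.2 ?_)
      rintro rfl
      simp at hu
      linarith
    exact DifferentiableAt.differentiableWithinAt (by fun_prop (disch := assumption))
  have hdc : DiffContOnCl ℂ (fun u : ℂ => u / (1 - u) ^ 2) (ball 0 |r|) := by
    rw [abs_of_pos hr]
    exact hd.diffContOnCl_ball subset_rfl
  simpa using hdc.circleAverage

/-- The average over the unit circle of `x * besselSlope (x * (1 - u) ^ 2 / u)`. -/
noncomputable def besselAvg (x : ℂ) : ℂ :=
  circleAverage (fun u : ℂ => x * besselSlope (x * (1 - u) ^ 2 / u)) 0 1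

theorem circleMap_mul_ne_one {r : ℝ} (hr : 0 < r) (hr1 : r < 1) (θ φ : ℝ) :
    circleMap 0 r θ * circleMap 0 1 φ ≠ 1 := by
  intro h
  have := congrArg norm h
  simp [abs_of_pos hr] at this
  linarith

theorem one_sub_circleMap_ne_zero {r : ℝ} (hr : 0 < r) (hr1 : r < 1) (θ : ℝ) :
    1 - circleMap 0 r θ ≠ 0 := by
  intro h
  have := congrArg norm (sub_eq_zero.1 h)
  simp [abs_of_pos hr] at this
  linarith

theorem circleAverage_circleAverage_exp {r : ℝ} (hr : 0 < r) (hr1 : r < 1) {a : ℂ} (ha : a ≠ 0)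
    (b : ℂ) :
    circleAverage (fun z₁ => circleAverage (fun z₂ =>
      Complex.exp (a * (z₂⁻¹ - z₁) + b * (z₁⁻¹ - z₂)) * (z₁ * z₂ / (1 - z₁ * z₂) ^ 2)) 0 1) 0 r =
      besselAvg (a * b) := by
  set G : ℂ → ℂ → ℂ := fun z u =>
    Complex.exp ((1 - u) * a / u * z + (1 - u) * b / z) * (u / (1 - u) ^ 2) with hG
  have hne : ∀ θ : ℝ, circleMap 0 r θ ≠ 0 := fun θ => circleMap_ne_center hr.ne'
  have hne1 : ∀ θ : ℝ, 1 - circleMap 0 r θ ≠ 0 := one_sub_circleMap_ne_zero hr hr1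
  have h1 : ∀ z₁ ∈ sphere (0 : ℂ) |r|, circleAverage (fun z₂ =>
      Complex.exp (a * (z₂⁻¹ - z₁) + b * (z₁⁻¹ - z₂)) * (z₁ * z₂ / (1 - z₁ * z₂) ^ 2)) 0 1 =
      circleAverage (fun u => G z₁ u) 0 r := by
    intro z₁ hz₁
    rw [mem_sphere_zero_iff_norm, abs_of_pos hr] at hz₁
    have hz0 : z₁ ≠ 0 := norm_pos_iff.1 (hz₁ ▸ hr)
    have := circleAverage_comp_mul_left (G z₁) z₁ 1
    rw [hz₁, mul_one] at this
    rw [← this]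
    refine circleAverage_congr_sphere fun z₂ hz₂ => ?_
    have hz20 : z₂ ≠ 0 := by rintro rfl; simp at hz₂
    simp only [hG]
    congr 2
    field_simp
  rw [circleAverage_congr_sphere h1, circleAverage_circleAverage_swap]
  · have h2 : ∀ u ∈ sphere (0 : ℂ) |r|, circleAverage (fun z => G z u) 0 r =
        u / (1 - u) ^ 2 + a * b * besselSlope (a * b * (1 - u) ^ 2 / u) := by
      intro u hu
      rw [mem_sphere_zero_iff_norm, abs_of_pos hr] at hu
      have hu0 : u ≠ 0 := norm_pos_iff.1 (hu ▸ hr)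
      have hu1 : 1 - u ≠ 0 := by
        refine sub_ne_zero.2 ?_
        rintro rfl
        simp at hu
        linarith
      have h3 := circleAverage_exp_mul_add_div (p := (1 - u) * a / u)
        (div_ne_zero (mul_ne_zero hu1 ha) hu0) ((1 - u) * b) hr
      have h4 := mul_besselSlope (a * b * (1 - u) ^ 2 / u)
      have h5 : (1 - u) * a / u * ((1 - u) * b) = a * b * (1 - u) ^ 2 / u := by ring
      have h6 : circleAverage (fun z => G z u) 0 r =
          (u / (1 - u) ^ 2) • circleAverage (fun z =>
            Complex.exp ((1 - u) * a / u * z + (1 - u) * b / z)) 0 r := by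
        rw [← circleAverage_fun_smul]
        simp only [hG, smul_eq_mul, mul_comm]
      rw [h6, h3, h5, eq_add_of_sub_eq h4.symm, smul_eq_mul]
      field_simp
      ring
    have hB : Continuous fun θ : ℝ =>
        a * b * besselSlope (a * b * (1 - circleMap 0 r θ) ^ 2 / circleMap 0 r θ) := by
      refine continuous_const.mul (differentiable_besselSlope.continuous.comp ?_)
      fun_prop (disch := intro θ; exact hne θ)
    rw [circleAverage_congr_sphere h2, circleAverage_fun_add, circleAverage_div_one_sub_sq hr hr1,
      zero_add, besselAvg]
    · refine circleAverage_eq_of_differentiableAt hr one_pos fun z hz => ?_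
      refine (differentiable_besselSlope.differentiableAt.fun_comp' z ?_).const_mul _
      fun_prop (disch := assumption)
    · refine Continuous.intervalIntegrable ?_ _ _
      fun_prop (disch := intro θ; exact pow_ne_zero 2 (hne1 θ))
    · exact hB.intervalIntegrable _ _
  · simp only [hG]
    have : ∀ p : ℝ × ℝ, circleMap 0 r p.1 ≠ 0 := fun p => hne _
    have : ∀ p : ℝ × ℝ, circleMap 0 r p.2 ≠ 0 := fun p => hne _
    have : ∀ p : ℝ × ℝ, (1 - circleMap 0 r p.2) ^ 2 ≠ 0 := fun p => pow_ne_zero 2 (hne1 _)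
    fun_prop (disch := assumption)

end CircleAverages

section Decomposition

open Real MeasureTheory Metric

theorem norm_cfun_le {z : ℂ} (hz : ‖z‖ = 1) : ‖cfun z‖ ≤ 1 := by
  rw [cfun, norm_div, Complex.norm_ofNat]
  have := norm_add_le z z⁻¹
  rw [norm_inv, hz] at this
  linarith

theorem one_add_sq_sub_ne_zero {γ r : ℝ} (hγ : 0 < γ) (hr : r < 1 / (4 + 4 * γ)) {z w : ℂ}
    (hz : ‖z‖ ≤ r) (hw : ‖w‖ = 1) : 1 + z ^ 2 - 2 * z * (cfun w + 2 * γ) ≠ 0 := by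
  intro h
  have h1 : (1 : ℂ) = z * (2 * (cfun w + 2 * γ) - z) := by linear_combination h
  have h2 : ‖2 * (cfun w + 2 * γ) - z‖ ≤ 2 * (1 + 2 * γ) + r := by
    refine (norm_sub_le _ _).trans (add_le_add ?_ hz)
    rw [norm_mul, Complex.norm_ofNat]
    gcongr
    refine (norm_add_le _ _).trans (add_le_add (norm_cfun_le hw) ?_)
    simp [abs_of_pos hγ]
  have h3 : (1 : ℝ) ≤ r * (2 * (1 + 2 * γ) + r) := by
    calc (1 : ℝ) = ‖z * (2 * (cfun w + 2 * γ) - z)‖ := by rw [← h1, norm_one]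
      _ ≤ _ := by rw [norm_mul]; gcongr; exact (norm_nonneg _).trans hz
  have h4 : r * (4 + 4 * γ) < 1 := by rwa [lt_div_iff₀ (by positivity)] at hr
  have h5 : 0 ≤ r := (norm_nonneg _).trans hz
  nlinarith

theorem cfun_sub_cfun_sub {z w : ℂ} {γ : ℝ} (hz : z ≠ 0) :
    cfun z - cfun w - 2 * γ = (1 + z ^ 2 - 2 * z * (cfun w + 2 * γ)) / (2 * z) := by
  rw [cfun]
  field_simp
  ring

theorem circleAverage_circleAverage_inv_eq_zero {γ r : ℝ} (hγ : 0 < γ) (hr : 0 < r) (hr1 : r < 1)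
    (hr' : r < 1 / (4 + 4 * γ)) (t : ℂ) :
    circleAverage (fun z₁ => circleAverage (fun z₂ =>
      Complex.exp (2 * t * (z₂⁻¹ - z₁)) / (cfun z₁ - cfun z₂ - 2 * γ) *
        (z₁ * z₂ / (1 - z₁ * z₂) ^ 2)) 0 1) 0 r = 0 := by
  have hn : ∀ θ : ℝ, ‖circleMap 0 r θ‖ = r := fun θ => by simp [abs_of_pos hr]
  have hn1 : ∀ θ : ℝ, ‖circleMap 0 1 θ‖ = 1 := fun θ => by simp
  rw [circleAverage_circleAverage_swap]
  · refine (circleAverage_congr_sphere (f₂ := fun _ => (0 : ℂ)) fun w hw => ?_).trans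
      (circleAverage_const 0 0 1)
    rw [abs_one, mem_sphere_zero_iff_norm] at hw
    set g : ℂ → ℂ := fun z => Complex.exp (2 * t * (w⁻¹ - z)) *
      (2 * z ^ 2 * w / ((1 + z ^ 2 - 2 * z * (cfun w + 2 * γ)) * (1 - z * w) ^ 2)) with hg
    have hgd : DifferentiableOn ℂ g (closedBall 0 r) := by
      intro z hz
      rw [mem_closedBall_zero_iff] at hz
      have h1 := one_add_sq_sub_ne_zero hγ hr' hz hw
      have h2 : (1 + z ^ 2 - 2 * z * (cfun w + 2 * γ)) * (1 - z * w) ^ 2 ≠ 0 := by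
        refine mul_ne_zero h1 (pow_ne_zero 2 fun h => ?_)
        have := congrArg norm (sub_eq_zero.1 h)
        rw [norm_one, norm_mul, hw] at this
        linarith
      exact DifferentiableAt.differentiableWithinAt (by fun_prop (disch := assumption))
    have hgc : DiffContOnCl ℂ g (ball 0 |r|) := by
      rw [abs_of_pos hr]
      exact hgd.diffContOnCl_ball subset_rfl
    have hg0 := hgc.circleAverage
    rw [show g 0 = 0 by simp [hg]] at hg0
    refine (circleAverage_congr_sphere (f₂ := g) fun z hz => ?_).trans hg0
    rw [abs_of_pos hr, mem_sphere_zero_iff_norm] at hz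
    have hz0 : z ≠ 0 := norm_pos_iff.1 (hz ▸ hr)
    have h1 := one_add_sq_sub_ne_zero hγ hr' hz.le hw
    simp only [hg]
    rw [cfun_sub_cfun_sub hz0, div_div_eq_mul_div]
    simp only [div_eq_mul_inv, mul_inv]
    ring
  · have hD : ∀ p : ℝ × ℝ,
        cfun (circleMap 0 r p.1) - cfun (circleMap 0 1 p.2) - 2 * (γ : ℂ) ≠ 0 := fun p => by
      have hz0 : circleMap 0 r p.1 ≠ 0 := circleMap_ne_center hr.ne'
      rw [cfun_sub_cfun_sub hz0]
      exact div_ne_zero (one_add_sq_sub_ne_zero hγ hr' (hn _).le (hn1 _))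
        (mul_ne_zero two_ne_zero hz0)
    have h1 : ∀ p : ℝ × ℝ, circleMap 0 r p.1 ≠ 0 := fun p => circleMap_ne_center hr.ne'
    have h2 : ∀ p : ℝ × ℝ, circleMap 0 1 p.2 ≠ 0 := fun p => circleMap_ne_center one_ne_zero
    have h3 : ∀ p : ℝ × ℝ, (1 - circleMap 0 r p.1 * circleMap 0 1 p.2) ^ 2 ≠ 0 := fun p =>
      pow_ne_zero 2 (sub_ne_zero.2 (circleMap_mul_ne_one hr hr1 _ _).symm)
    unfold cfun at hD ⊢
    fun_prop (disch := assumption)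

theorem circleAverage_circleAverage_add {f g : ℂ → ℂ → ℂ} {r R : ℝ}
    (hf : Continuous fun p : ℝ × ℝ => f (circleMap 0 r p.1) (circleMap 0 R p.2))
    (hg : Continuous fun p : ℝ × ℝ => g (circleMap 0 r p.1) (circleMap 0 R p.2)) :
    circleAverage (fun z => circleAverage (fun w => f z w + g z w) 0 R) 0 r =
      circleAverage (fun z => circleAverage (fun w => f z w) 0 R) 0 r +
        circleAverage (fun z => circleAverage (fun w => g z w) 0 R) 0 r := by
  have key : ∀ {f : ℂ → ℂ → ℂ},
      (Continuous fun p : ℝ × ℝ => f (circleMap 0 r p.1) (circleMap 0 R p.2)) →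
      (∀ θ, CircleIntegrable (fun w => f (circleMap 0 r θ) w) 0 R) ∧
        CircleIntegrable (fun z => circleAverage (fun w => f z w) 0 R) 0 r := by
    refine fun hf => ⟨fun θ => Continuous.intervalIntegrable ?_ _ _,
      Continuous.intervalIntegrable ?_ _ _⟩
    · exact hf.comp (by fun_prop : Continuous fun φ : ℝ => (θ, φ))
    · simp only [circleAverage_def]
      exact (intervalIntegral.continuous_parametric_intervalIntegral_of_continuous' hf _ _).const_smul
        _
  rw [← circleAverage_fun_add (key hf).2 (key hg).2]
  simp only [circleAverage_def (R := r)]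
  congr 2 with θ
  exact circleAverage_fun_add ((key hf).1 θ) ((key hg).1 θ)

theorem circleAverage_circleAverage_integral {f : ℝ → ℂ → ℂ → ℂ} {r R : ℝ}
    (hf : Continuous fun p : ℝ × ℝ × ℝ => f p.1 (circleMap 0 r p.2.1) (circleMap 0 R p.2.2))
    (a b : ℝ) :
    circleAverage (fun z => circleAverage (fun w => ∫ s in a..b, f s z w) 0 R) 0 r =
      ∫ s in a..b, circleAverage (fun z => circleAverage (fun w => f s z w) 0 R) 0 r := by
  have h1 : ∀ θ : ℝ, circleAverage (fun w => ∫ s in a..b, f s (circleMap 0 r θ) w) 0 R =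
      ∫ s in a..b, circleAverage (fun w => f s (circleMap 0 r θ) w) 0 R := fun θ => by
    simp only [circleAverage_def, intervalIntegral.integral_smul]
    rw [integral_integral_swap_of_continuous
      (f := fun φ s => f s (circleMap 0 r θ) (circleMap 0 R φ))
      (hf.comp (by fun_prop : Continuous fun p : ℝ × ℝ => (p.2, θ, p.1)))]
  have h2 : Continuous fun p : ℝ × ℝ =>
      circleAverage (fun w => f p.2 (circleMap 0 r p.1) w) 0 R := by
    simp only [circleAverage_def]
    refine Continuous.const_smul ?_ _
    exact intervalIntegral.continuous_parametric_intervalIntegral_of_continuous'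
      (f := fun (p : ℝ × ℝ) φ => f p.2 (circleMap 0 r p.1) (circleMap 0 R φ))
      (hf.comp (by fun_prop : Continuous fun p : (ℝ × ℝ) × ℝ => (p.1.2, p.1.1, p.2))) _ _
  simp only [circleAverage_def (R := r), h1, intervalIntegral.integral_smul]
  rw [integral_integral_swap_of_continuous
    (f := fun θ s => circleAverage (fun w => f s (circleMap 0 r θ) w) 0 R) h2]

theorem circleAverage_circleAverage_const_mul (c : ℂ) (f : ℂ → ℂ → ℂ) (r R : ℝ) :
    circleAverage (fun z => circleAverage (fun w => c * f z w) 0 R) 0 r =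
      c * circleAverage (fun z => circleAverage (fun w => f z w) 0 R) 0 r := by
  simp only [← smul_eq_mul, circleAverage_fun_smul]

theorem exp_epsfun_mul_eq {γ : ℝ} {z w : ℂ} (hD : cfun z - cfun w - 2 * (γ : ℂ) ≠ 0) (t : ℝ)
    (R : ℂ) :
    Complex.exp (t * (epsfun γ z + epsfun γ w)) *
        ((cfun z - cfun w) / (cfun z - cfun w - 2 * γ)) * R =
      (Complex.exp (-4 * γ * t) * (Complex.exp ((2 * t - t) * (w⁻¹ - z) + t * (z⁻¹ - w)) * R) +
        4 * γ * ∫ s in 0..t, Complex.exp (-4 * γ * s) *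
          (Complex.exp ((2 * t - s) * (w⁻¹ - z) + s * (z⁻¹ - w)) * R)) +
        2 * γ * (Complex.exp (2 * t * (w⁻¹ - z)) / (cfun z - cfun w - 2 * γ) * R) := by
  set D := cfun z - cfun w - 2 * (γ : ℂ) with hDdef
  have e1 : ∀ s : ℝ, Complex.exp (-4 * γ * s) *
      (Complex.exp ((2 * t - s) * (w⁻¹ - z) + s * (z⁻¹ - w)) * R) =
      Complex.exp (2 * t * (w⁻¹ - z)) * R * Complex.exp (2 * D * s) := by
    intro s
    have : -4 * (γ : ℂ) * s + ((2 * t - s) * (w⁻¹ - z) + s * (z⁻¹ - w)) =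
        2 * t * (w⁻¹ - z) + 2 * D * s := by
      rw [hDdef, cfun, cfun]
      ring
    rw [← mul_assoc, ← Complex.exp_add, this, Complex.exp_add]
    ring
  have e2 : Complex.exp (t * (epsfun γ z + epsfun γ w)) =
      Complex.exp (2 * t * (w⁻¹ - z)) * Complex.exp (2 * D * t) := by
    rw [← Complex.exp_add, hDdef, cfun, cfun, epsfun, epsfun]
    congr 1
    ring
  have e3 : cfun z - cfun w = D + 2 * γ := by rw [hDdef]; ring
  simp only [e1]
  rw [intervalIntegral.integral_const_mul,
    integral_exp_mul_complex (mul_ne_zero two_ne_zero hD), e2, e3]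
  simp only [Complex.ofReal_zero, mul_zero, Complex.exp_zero]
  field_simp
  ring

theorem q1_eq_besselAvg {γ r t : ℝ} (hγ : 0 < γ) (hr : 0 < r) (hr1 : r < 1)
    (hr' : r < 1 / (4 + 4 * γ)) (ht : 0 < t) :
    q1 γ r t = Complex.exp (-4 * γ * t) * besselAvg (t ^ 2) +
      4 * γ * ∫ s in 0..t, Complex.exp (-4 * γ * s) * besselAvg ((2 * t - s) * s) := by
  obtain ⟨K, hK⟩ : ∃ K : ℝ → ℂ → ℂ → ℂ, K = fun (s : ℝ) z₁ z₂ =>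
    Complex.exp ((2 * t - s) * (z₂⁻¹ - z₁) + s * (z₁⁻¹ - z₂)) *
      (z₁ * z₂ / (1 - z₁ * z₂) ^ 2) := ⟨_, rfl⟩
  obtain ⟨V, hV⟩ : ∃ V : ℂ → ℂ → ℂ, V = fun z₁ z₂ =>
    Complex.exp (2 * t * (z₂⁻¹ - z₁)) / (cfun z₁ - cfun z₂ - 2 * γ) *
        (z₁ * z₂ / (1 - z₁ * z₂) ^ 2) := ⟨_, rfl⟩
  have hne : ∀ θ, circleMap 0 r θ ≠ 0 := fun θ => circleMap_ne_center hr.ne'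
  have hne1 : ∀ θ, circleMap 0 1 θ ≠ 0 := fun θ => circleMap_ne_center one_ne_zero
  have hD : ∀ θ φ : ℝ,
      cfun (circleMap 0 r θ) - cfun (circleMap 0 1 φ) - 2 * (γ : ℂ) ≠ 0 := fun θ φ => by
    rw [cfun_sub_cfun_sub (hne θ)]
    exact div_ne_zero (one_add_sq_sub_ne_zero hγ hr' (by simp [abs_of_pos hr]) (by simp))
      (mul_ne_zero two_ne_zero (hne θ))
  have h1 : ∀ p : ℝ × ℝ × ℝ, circleMap 0 r p.2.1 ≠ 0 := fun p => hne _
  have h2 : ∀ p : ℝ × ℝ × ℝ, circleMap 0 1 p.2.2 ≠ 0 := fun p => hne1 _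
  have h3 : ∀ p : ℝ × ℝ × ℝ, (1 - circleMap 0 r p.2.1 * circleMap 0 1 p.2.2) ^ 2 ≠ 0 := fun p =>
    pow_ne_zero 2 (sub_ne_zero.2 (circleMap_mul_ne_one hr hr1 _ _).symm)
  have h4 : ∀ p : ℝ × ℝ × ℝ,
      cfun (circleMap 0 r p.2.1) - cfun (circleMap 0 1 p.2.2) - 2 * (γ : ℂ) ≠ 0 := fun p => hD _ _
  have hKc : Continuous fun p : ℝ × ℝ × ℝ =>
      K p.1 (circleMap 0 r p.2.1) (circleMap 0 1 p.2.2) := by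
    simp only [hK]
    fun_prop (disch := assumption)
  have hIc : Continuous fun p : ℝ × ℝ × ℝ =>
      Complex.exp (-4 * γ * p.1) * K p.1 (circleMap 0 r p.2.1) (circleMap 0 1 p.2.2) :=
    (by fun_prop : Continuous fun p : ℝ × ℝ × ℝ => Complex.exp (-4 * γ * p.1)).mul hKc
  have hVc : Continuous fun p : ℝ × ℝ × ℝ => V (circleMap 0 r p.2.1) (circleMap 0 1 p.2.2) := by
    simp only [hV]
    unfold cfun at h4 ⊢
    fun_prop (disch := assumption)
  have hsec : Continuous fun p : ℝ × ℝ => (t, p.1, p.2) := by fun_prop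
  have hK_avg : ∀ s : ℝ, s < 2 * t →
      circleAverage (fun z₁ => circleAverage (fun z₂ => K s z₁ z₂) 0 1) 0 r =
        besselAvg ((2 * t - s) * s) := fun s hs => by
    rw [hK]
    exact circleAverage_circleAverage_exp hr hr1
      (by exact_mod_cast (sub_pos.2 hs).ne' : (2 * (t : ℂ) - s) ≠ 0) s
  have hsplit : ∀ θ φ : ℝ,
      Complex.exp (t * (epsfun γ (circleMap 0 r θ) + epsfun γ (circleMap 0 1 φ))) *
        ((cfun (circleMap 0 r θ) - cfun (circleMap 0 1 φ)) /
          (cfun (circleMap 0 r θ) - cfun (circleMap 0 1 φ) - 2 * γ)) *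
        (circleMap 0 r θ * circleMap 0 1 φ / (1 - circleMap 0 r θ * circleMap 0 1 φ) ^ 2) =
      (Complex.exp (-4 * γ * t) * K t (circleMap 0 r θ) (circleMap 0 1 φ) +
        4 * γ * ∫ s in 0..t,
          Complex.exp (-4 * γ * s) * K s (circleMap 0 r θ) (circleMap 0 1 φ)) +
        2 * γ * V (circleMap 0 r θ) (circleMap 0 1 φ) := by
    intro θ φ
    rw [hK, hV]
    exact exp_epsfun_mul_eq (hD θ φ) t _
  have hq : q1 γ r t = circleAverage (fun z₁ => circleAverage (fun z₂ =>
      (Complex.exp (-4 * γ * t) * K t z₁ z₂ +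
        4 * γ * ∫ s in 0..t, Complex.exp (-4 * γ * s) * K s z₁ z₂) + 2 * γ * V z₁ z₂) 0 1) 0 r := by
    rw [q1, cint_eq_circleAverage hr.ne']
    simp only [cint_eq_circleAverage one_ne_zero, circleAverage_def, hsplit]
  have hint : Continuous fun p : ℝ × ℝ => 4 * (γ : ℂ) * ∫ s in 0..t,
      Complex.exp (-4 * γ * s) * K s (circleMap 0 r p.1) (circleMap 0 1 p.2) := by
    refine continuous_const.mul ?_
    exact intervalIntegral.continuous_parametric_intervalIntegral_of_continuous'
      (f := fun (p : ℝ × ℝ) s =>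
        Complex.exp (-4 * γ * s) * K s (circleMap 0 r p.1) (circleMap 0 1 p.2))
      (hIc.comp (by fun_prop : Continuous fun p : (ℝ × ℝ) × ℝ => (p.2, p.1.1, p.1.2))) _ _
  have hKt : Continuous fun p : ℝ × ℝ =>
      Complex.exp (-4 * γ * t) * K t (circleMap 0 r p.1) (circleMap 0 1 p.2) := hIc.comp hsec
  have hVt : Continuous fun p : ℝ × ℝ =>
      2 * (γ : ℂ) * V (circleMap 0 r p.1) (circleMap 0 1 p.2) :=
    continuous_const.mul (hVc.comp hsec)
  rw [hq, circleAverage_circleAverage_add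
      (f := fun z₁ z₂ => Complex.exp (-4 * γ * t) * K t z₁ z₂ +
        4 * γ * ∫ s in 0..t, Complex.exp (-4 * γ * s) * K s z₁ z₂)
      (g := fun z₁ z₂ => 2 * γ * V z₁ z₂) (hKt.add hint) hVt,
    circleAverage_circleAverage_add
      (f := fun z₁ z₂ => Complex.exp (-4 * γ * t) * K t z₁ z₂)
      (g := fun z₁ z₂ => 4 * γ * ∫ s in 0..t, Complex.exp (-4 * γ * s) * K s z₁ z₂) hKt hint,
    circleAverage_circleAverage_const_mul, circleAverage_circleAverage_const_mul,
    circleAverage_circleAverage_const_mul, hV,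
    circleAverage_circleAverage_inv_eq_zero hγ hr hr1 hr' t, mul_zero, add_zero,
    hK_avg t (by linarith),
    circleAverage_circleAverage_integral
      (f := fun s z₁ z₂ => Complex.exp (-4 * γ * s) * K s z₁ z₂) hIc]
  congr 2
  · congr 1
    ring
  · refine intervalIntegral.integral_congr fun s hs => ?_
    rw [Set.uIcc_of_le ht.le] at hs
    simp only [circleAverage_circleAverage_const_mul]
    rw [hK_avg s (by linarith [hs.2])]

end Decomposition

section SincIntegral

open Real MeasureTheory Set

theorem sinc_mul_self (x : ℝ) : sinc x * x = sin x := by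
  rcases eq_or_ne x 0 with rfl | hx
  · simp
  · rw [sinc_of_ne_zero hx, div_mul_cancel₀ _ hx]

theorem sinc_sq_le (x : ℝ) : sinc x ^ 2 ≤ 2 * (1 + x ^ 2)⁻¹ := by
  rw [← div_eq_mul_inv, le_div_iff₀ (by positivity)]
  have h1 : sinc x ^ 2 ≤ 1 := (sq_le_one_iff_abs_le_one _).2 (abs_sinc_le_one x)
  have h2 : (sinc x * x) ^ 2 ≤ 1 := by
    rw [sinc_mul_self]
    exact sin_sq_le_one x
  nlinarith

theorem one_sub_cos_eq_sinc (x : ℝ) : 1 - cos x = x ^ 2 / 2 * sinc (x / 2) ^ 2 := by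
  have h1 := sinc_mul_self (x / 2)
  have h2 := cos_two_mul (x / 2)
  rw [mul_div_cancel₀ x two_ne_zero] at h2
  have h3 := sin_sq_add_cos_sq (x / 2)
  have h4 : sin (x / 2) ^ 2 = sinc (x / 2) ^ 2 * (x ^ 2 / 4) := by rw [← h1]; ring
  linarith

theorem integrableOn_exp_neg_mul_one_sub_cos (v : ℝ) :
    IntegrableOn (fun y : ℝ => exp (-y) * (1 - cos (y * v))) (Ioi 0) := by
  refine ((integrableOn_exp_neg_Ioi 0).const_mul 2).mono' (by fun_prop) (.of_forall fun y => ?_)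
  have h1 := cos_le_one (y * v)
  have h2 := neg_one_le_cos (y * v)
  rw [norm_of_nonneg (mul_nonneg (exp_pos _).le (by linarith))]
  nlinarith [exp_pos (-y)]

theorem integral_exp_neg_mul_one_sub_cos (v : ℝ) :
    ∫ y in Ioi (0 : ℝ), exp (-y) * (1 - cos (y * v)) = v ^ 2 / (1 + v ^ 2) := by
  have ha : (-1 + v * Complex.I).re < 0 := by simp
  have h1 := integral_exp_mul_complex_Ioi ha 0
  have hi := integrableOn_exp_mul_complex_Ioi ha 0
  have h2 := congrArg Complex.re h1
  rw [← RCLike.re_eq_complex_re, ← integral_re hi] at h2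
  have h3 : ∀ y : ℝ, RCLike.re (Complex.exp ((-1 + v * Complex.I) * y)) =
      exp (-y) * cos (y * v) := by
    intro y
    rw [RCLike.re_eq_complex_re, Complex.exp_re]
    simp [mul_comm]
  have hi' := hi.re
  simp only [h3] at h2 hi'
  simp only [mul_sub, mul_one]
  rw [integral_sub (integrableOn_exp_neg_Ioi 0) hi', h2, integral_exp_neg_Ioi_zero]
  have h4 : (1 + v ^ 2) ≠ 0 := by positivity
  simp [Complex.div_re, Complex.normSq_apply]
  field_simp
  ring

/-- The Dirichlet-type integral `∫₀^∞ (sin x / x)² dx = π / 2`. -/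
theorem integral_Ioi_sinc_sq : ∫ x in Ioi (0 : ℝ), sinc x ^ 2 = π / 2 := by
  set g : ℝ → ℝ → ℝ := fun v y => exp (-y) * (y ^ 2 / 2 * sinc (v * (y / 2)) ^ 2) with hg
  have hgc : Continuous (Function.uncurry g) := by
    have := continuous_sinc
    simp only [hg, Function.uncurry_def]
    fun_prop
  have hgv : ∀ v ∈ Ioi (0 : ℝ), ∀ y, g v y = (v ^ 2)⁻¹ * (exp (-y) * (1 - cos (y * v))) := by
    intro v hv y
    have hv' : v ≠ 0 := (mem_Ioi.1 hv).ne'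
    rw [one_sub_cos_eq_sinc, hg]
    simp only [show y * v / 2 = v * (y / 2) by ring]
    field_simp
  have hint : ∀ v ∈ Ioi (0 : ℝ), ∫ y in Ioi (0 : ℝ), g v y = (1 + v ^ 2)⁻¹ := by
    intro v hv
    have hv' : v ≠ 0 := (mem_Ioi.1 hv).ne'
    have : 1 + v ^ 2 ≠ 0 := by positivity
    simp only [hgv v hv]
    rw [integral_const_mul, integral_exp_neg_mul_one_sub_cos]
    field_simp
  have hg0 : ∀ v y, 0 ≤ g v y := fun v y => by positivity
  have hprod : Integrable (Function.uncurry g)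
      ((volume.restrict (Ioi (0 : ℝ))).prod (volume.restrict (Ioi (0 : ℝ)))) := by
    rw [integrable_prod_iff hgc.aestronglyMeasurable]
    constructor
    · refine (ae_restrict_mem measurableSet_Ioi).mono fun v hv => ?_
      simp only [Function.uncurry_apply_pair, hgv v hv]
      exact (integrableOn_exp_neg_mul_one_sub_cos v).const_mul _
    · simp only [Function.uncurry_apply_pair, norm_of_nonneg (hg0 _ _)]
      exact integrable_inv_one_add_sq.integrableOn.congr_fun (fun v hv => (hint v hv).symm)
        measurableSet_Ioi
  have hswap := integral_integral_swap hprod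
  rw [setIntegral_congr_fun measurableSet_Ioi hint, integral_Ioi_inv_one_add_sq] at hswap
  have hy : ∀ y ∈ Ioi (0 : ℝ), ∫ v in Ioi (0 : ℝ), g v y =
      (∫ x in Ioi (0 : ℝ), sinc x ^ 2) * (y ^ ((2 : ℝ) - 1) * exp (-(1 * y))) := by
    intro y hy
    have hy' : 0 < y / 2 := half_pos hy
    have hy0 : y ≠ 0 := (mem_Ioi.1 hy).ne'
    have h := integral_comp_mul_right_Ioi (fun x => sinc x ^ 2) 0 hy'
    simp only [zero_mul] at h
    simp only [hg, integral_const_mul]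
    rw [h, show (2 : ℝ) - 1 = 1 by norm_num, rpow_one, one_mul, smul_eq_mul]
    field_simp
  rw [setIntegral_congr_fun measurableSet_Ioi hy, integral_const_mul,
    integral_rpow_mul_exp_neg_mul_Ioi two_pos one_pos] at hswap
  simp at hswap
  exact hswap.symm

end SincIntegral

section QuarterPeriod

open Real MeasureTheory Set

/-- The normalized quarter-period integral of `sinc (y sin ψ) ^ 2`. -/
noncomputable def sincAvg (y : ℝ) : ℝ := ∫ ψ in (0)..(π / 2), y * sinc (y * sin ψ) ^ 2

theorem sincAvg_eq_integral_Ioi {y : ℝ} (hy : 0 < y) :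
    sincAvg y = ∫ v in Ioi (0 : ℝ),
      (Iic (y * (π / 2))).indicator (fun v => sinc (y * sin (v / y)) ^ 2) v := by
  rw [setIntegral_indicator measurableSet_Iic, Ioi_inter_Iic,
    ← intervalIntegral.integral_of_le (by positivity), sincAvg, intervalIntegral.integral_const_mul]
  have h := intervalIntegral.mul_integral_comp_mul_left (a := 0) (b := π / 2) y
    (f := fun v => sinc (y * sin (v / y)) ^ 2)
  simp only [mul_div_cancel_left₀ _ hy.ne', mul_zero] at h
  exact h

theorem sinc_mul_sin_sq_le {y v : ℝ} (hy : 0 < y) (hv : 0 ≤ v) (hvy : v ≤ y * (π / 2)) :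
    sinc (y * sin (v / y)) ^ 2 ≤ 5 * (1 + v ^ 2)⁻¹ := by
  have h1 : 2 / π * (v / y) ≤ sin (v / y) :=
    mul_le_sin (by positivity) (by rwa [div_le_iff₀' hy])
  have h2 : 2 / π * v ≤ y * sin (v / y) := by
    calc 2 / π * v = y * (2 / π * (v / y)) := by field_simp
      _ ≤ _ := by gcongr
  have h3 : (2 / π * v) ^ 2 ≤ (y * sin (v / y)) ^ 2 := by
    gcongr
  have h4 : 2 / 5 ≤ (2 / π) ^ 2 := by
    rw [div_pow, div_le_div_iff₀ (by norm_num) (by positivity)]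
    nlinarith [pi_lt_d2, pi_pos]
  refine (sinc_sq_le _).trans ?_
  rw [← div_eq_mul_inv, ← div_eq_mul_inv, div_le_div_iff₀ (by positivity) (by positivity)]
  rw [mul_pow] at h3
  nlinarith [mul_le_mul_of_nonneg_right h4 (sq_nonneg v), sq_nonneg v]

theorem norm_indicator_sinc_le {y v : ℝ} (hy : 0 < y) (hv : 0 ≤ v) :
    ‖(Iic (y * (π / 2))).indicator (fun v => sinc (y * sin (v / y)) ^ 2) v‖ ≤
      5 * (1 + v ^ 2)⁻¹ := by
  by_cases h : v ≤ y * (π / 2)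
  · rw [indicator_of_mem (mem_Iic.2 h), norm_of_nonneg (sq_nonneg _)]
    exact sinc_mul_sin_sq_le hy hv h
  · rw [indicator_of_notMem (by simpa using h), norm_zero]
    positivity

theorem sincAvg_zero : sincAvg 0 = 0 := by simp [sincAvg]

theorem sincAvg_nonneg {y : ℝ} (hy : 0 ≤ y) : 0 ≤ sincAvg y :=
  intervalIntegral.integral_nonneg (by positivity) fun _ _ => by positivity

theorem sincAvg_le {y : ℝ} (hy : 0 ≤ y) : sincAvg y ≤ 5 * (π / 2) := by
  rcases hy.eq_or_lt with rfl | hy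
  · rw [sincAvg_zero]
    positivity
  · rw [sincAvg_eq_integral_Ioi hy]
    refine (le_abs_self _).trans ?_
    refine (norm_integral_le_of_norm_le (integrable_inv_one_add_sq.integrableOn.const_mul 5)
      ((ae_restrict_mem measurableSet_Ioi).mono fun v hv =>
        norm_indicator_sinc_le hy (mem_Ioi.1 hv).le)).trans ?_
    rw [integral_const_mul, integral_Ioi_inv_one_add_sq]
    simp

theorem continuous_sincAvg : Continuous sincAvg := by
  refine intervalIntegral.continuous_parametric_intervalIntegral_of_continuous'
    (f := fun y ψ => y * sinc (y * sin ψ) ^ 2) ?_ 0 (π / 2)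
  have := continuous_sinc
  fun_prop

theorem tendsto_sincAvg : Tendsto sincAvg atTop (nhds (π / 2)) := by
  rw [← integral_Ioi_sinc_sq]
  have h : Tendsto (fun y : ℝ => ∫ v in Ioi (0 : ℝ),
      (Iic (y * (π / 2))).indicator (fun v => sinc (y * sin (v / y)) ^ 2) v) atTop
      (nhds (∫ v in Ioi (0 : ℝ), sinc v ^ 2)) := by
    refine tendsto_integral_filter_of_dominated_convergence (fun v => 5 * (1 + v ^ 2)⁻¹) ?_ ?_
      (integrable_inv_one_add_sq.integrableOn.const_mul 5) ?_
    · refine .of_forall fun y => AEStronglyMeasurable.indicator ?_ measurableSet_Iic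
      have := continuous_sinc
      exact Continuous.aestronglyMeasurable (by fun_prop)
    · filter_upwards [eventually_gt_atTop 0] with y hy
      exact (ae_restrict_mem measurableSet_Ioi).mono fun v hv =>
        norm_indicator_sinc_le hy (mem_Ioi.1 hv).le
    · refine .of_forall fun v => ?_
      have h1 : Tendsto (fun y : ℝ => sinc (v * sinc (v / y)) ^ 2) atTop (nhds (sinc v ^ 2)) := by
        have h2 : Tendsto (fun y : ℝ => v / y) atTop (nhds 0) := tendsto_id.const_div_atTop v
        have h3 : Continuous fun x : ℝ => sinc (v * sinc x) ^ 2 := by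
          have := continuous_sinc
          fun_prop
        simpa [Function.comp_def] using (h3.tendsto 0).comp h2
      refine h1.congr' ?_
      have h4 : ∀ᶠ y : ℝ in atTop, v ≤ y * (π / 2) :=
        (tendsto_id.atTop_mul_const (by positivity)).eventually_ge_atTop v
      filter_upwards [eventually_gt_atTop 0, h4] with y hy hvy
      rw [indicator_of_mem (mem_Iic.2 hvy), ← sinc_mul_self (v / y)]
      congr 2
      field_simp
  refine h.congr' ?_
  filter_upwards [eventually_gt_atTop 0] with y hy
  exact (sincAvg_eq_integral_Ioi hy).symm

/-- The real form of `besselAvg`, see `besselAvg_ofReal`. -/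
noncomputable def besselAvgReal (x : ℝ) : ℝ :=
  √x / π ^ 2 * ∫ α in (0)..(2 * π), |cos α| * sincAvg (2 * √x * |cos α|)

theorem continuous_besselAvgReal : Continuous besselAvgReal := by
  refine Continuous.mul (by fun_prop) ?_
  refine intervalIntegral.continuous_parametric_intervalIntegral_of_continuous'
    (f := fun x α => |cos α| * sincAvg (2 * √x * |cos α|)) ?_ 0 (2 * π)
  have := continuous_sincAvg
  fun_prop

theorem integral_abs_cos : ∫ α in (0)..(2 * π), |cos α| = 4 := by
  have hper : Function.Periodic (fun α => |cos α|) π := fun α => by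
    simp only [cos_add_pi, abs_neg]
  have h1 : ∫ α in (-(π / 2))..(π / 2), |cos α| = 2 := by
    rw [intervalIntegral.integral_congr (g := cos), integral_cos]
    · simp
      norm_num
    · intro α hα
      rw [uIcc_of_le (by linarith [pi_pos])] at hα
      exact abs_of_nonneg (cos_nonneg_of_mem_Icc hα)
  have h2 := hper.intervalIntegral_add_zsmul_eq 2 0
    fun _ _ => (continuous_cos.abs).intervalIntegrable _ _
  rw [hper.intervalIntegral_add_eq 0 (-(π / 2)), show -(π / 2) + π = π / 2 by ring, h1] at h2
  simpa using h2.trans (by norm_num)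

theorem norm_abs_cos_mul_sincAvg_le (x α : ℝ) :
    ‖|cos α| * sincAvg (2 * √x * |cos α|)‖ ≤ 5 * (π / 2) := by
  have h : 0 ≤ 2 * √x * |cos α| := by positivity
  rw [norm_mul, norm_of_nonneg (sincAvg_nonneg h), norm_of_nonneg (abs_nonneg _)]
  calc _ ≤ 1 * (5 * (π / 2)) := by
        gcongr
        · exact sincAvg_nonneg h
        · exact abs_cos_le_one α
        · exact sincAvg_le h
    _ = _ := one_mul _

theorem norm_besselAvgReal_le (x : ℝ) : ‖besselAvgReal x‖ ≤ 5 * √x := by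
  have h := intervalIntegral.norm_integral_le_of_norm_le_const (a := 0) (b := 2 * π)
    fun α _ => norm_abs_cos_mul_sincAvg_le x α
  rw [sub_zero, abs_of_pos two_pi_pos] at h
  rw [besselAvgReal, norm_mul, norm_of_nonneg (by positivity)]
  calc _ ≤ √x / π ^ 2 * (5 * (π / 2) * (2 * π)) := by gcongr
    _ = _ := by field_simp

theorem tendsto_besselAvgReal_div_sqrt :
    Tendsto (fun x => besselAvgReal x / √x) atTop (nhds (2 / π)) := by
  have h : Tendsto (fun x => ∫ α in (0)..(2 * π), |cos α| * sincAvg (2 * √x * |cos α|)) atTop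
      (nhds (∫ α in (0)..(2 * π), |cos α| * (π / 2))) := by
    refine intervalIntegral.tendsto_integral_filter_of_dominated_convergence
      (fun _ => 5 * (π / 2)) ?_ ?_ intervalIntegrable_const ?_
    · have := continuous_sincAvg
      exact .of_forall fun x => Continuous.aestronglyMeasurable (by fun_prop)
    · exact .of_forall fun x => .of_forall fun α _ => norm_abs_cos_mul_sincAvg_le x α
    · refine .of_forall fun α _ => ?_
      rcases (abs_nonneg (cos α)).eq_or_lt with h0 | h0
      · simp [← h0]
      · refine (tendsto_sincAvg.comp ?_).const_mul _
        exact (tendsto_sqrt_atTop.const_mul_atTop two_pos).atTop_mul_const h0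
  rw [intervalIntegral.integral_mul_const, integral_abs_cos] at h
  have h' := h.const_mul (1 / π ^ 2)
  rw [show 1 / π ^ 2 * (4 * (π / 2)) = 2 / π by field_simp; norm_num] at h'
  refine h'.congr' ?_
  filter_upwards [eventually_gt_atTop 0] with x hx
  have := (sqrt_pos.2 hx).ne'
  rw [besselAvgReal]
  generalize (∫ α in (0)..(2 * π), |cos α| * sincAvg (2 * √x * |cos α|)) = J
  field_simp

end QuarterPeriod

section RealForm

open Real MeasureTheory

theorem circleMap_add_inv (θ : ℝ) :
    circleMap 0 1 θ + (circleMap 0 1 θ)⁻¹ = 2 * (cos θ : ℂ) := by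
  rw [circleMap_zero, Complex.ofReal_one, one_mul, ← Complex.exp_neg, Complex.ofReal_cos,
    Complex.cos]
  ring_nf

theorem besselGen_mul_self {p : ℂ} (hp : p ≠ 0) :
    besselGen (p * p) = (2 * π)⁻¹ * ∫ α in (0)..(2 * π), Complex.exp (2 * p * (cos α : ℂ)) := by
  rw [← circleAverage_exp_mul_add_div hp p one_pos, circleAverage_def, Complex.real_smul]
  push_cast
  congr 1
  refine intervalIntegral.integral_congr fun α _ => ?_
  simp only [div_eq_mul_inv, ← mul_add, circleMap_add_inv, Complex.ofReal_cos]
  congr 1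
  ring

theorem besselGen_neg_sq_div_four (y : ℝ) :
    besselGen (-(y : ℂ) ^ 2 / 4) = (2 * π)⁻¹ * ∫ α in (0)..(2 * π), (cos (y * cos α) : ℂ) := by
  rcases eq_or_ne y 0 with rfl | hy
  · simp [besselGen_zero]
    field_simp
  · have hp : Complex.I * y / 2 ≠ 0 := by simp [hy]
    have hq : -(Complex.I * y / 2) ≠ 0 := neg_ne_zero.2 hp
    have h1 := besselGen_mul_self hp
    have h2 := besselGen_mul_self hq
    have h3 : Complex.I * y / 2 * (Complex.I * y / 2) = -(y : ℂ) ^ 2 / 4 := by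
      ring_nf
      rw [Complex.I_sq]
      ring
    rw [neg_mul_neg] at h2
    rw [h3] at h1 h2
    have h4 : ∀ α : ℝ, (cos (y * cos α) : ℂ) =
        2⁻¹ * (Complex.exp (2 * (Complex.I * y / 2) * (cos α : ℂ)) +
          Complex.exp (2 * -(Complex.I * y / 2) * (cos α : ℂ))) := by
      intro α
      rw [Complex.ofReal_cos, Complex.cos]
      push_cast
      ring_nf
    simp only [h4]
    rw [intervalIntegral.integral_const_mul, intervalIntegral.integral_add]
    · linear_combination (h1 + h2) / 2
    · exact Continuous.intervalIntegrable (by fun_prop) _ _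
    · exact Continuous.intervalIntegrable (by fun_prop) _ _

theorem mul_besselSlope_circleMap {x ψ : ℝ} (hx : 0 ≤ x) (hψ : sin ψ ≠ 0) :
    (x : ℂ) * besselSlope (x * (1 - circleMap 0 1 (2 * ψ)) ^ 2 / circleMap 0 1 (2 * ψ)) =
      (((2 * π)⁻¹ * ∫ α in (0)..(2 * π),
        2 * x * cos α ^ 2 * sinc (2 * √x * sin ψ * cos α) ^ 2 : ℝ) : ℂ) := by
  rcases hx.eq_or_lt with rfl | hx0
  · simp
  have hu : circleMap 0 1 (2 * ψ) ≠ 0 := circleMap_ne_center one_ne_zero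
  have h1 : (x : ℂ) * (1 - circleMap 0 1 (2 * ψ)) ^ 2 / circleMap 0 1 (2 * ψ) =
      -((4 * √x * sin ψ : ℝ) : ℂ) ^ 2 / 4 := by
    have h2 := circleMap_add_inv (2 * ψ)
    have h3 : (1 - circleMap 0 1 (2 * ψ)) ^ 2 / circleMap 0 1 (2 * ψ) = -4 * (sin ψ : ℂ) ^ 2 := by
      have h4 : (1 - circleMap 0 1 (2 * ψ)) ^ 2 / circleMap 0 1 (2 * ψ) =
          circleMap 0 1 (2 * ψ) + (circleMap 0 1 (2 * ψ))⁻¹ - 2 := by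
        field_simp
        ring
      rw [h4, h2, cos_two_mul, cos_sq']
      push_cast
      ring
    have h5 : ((√x : ℝ) : ℂ) ^ 2 = x := by rw [← Complex.ofReal_pow, sq_sqrt hx]
    rw [mul_div_assoc, h3]
    push_cast
    rw [← h5]
    ring
  have hs : (-4 * x * sin ψ ^ 2 : ℝ) ≠ 0 := by
    simp [hx0.ne', hψ]
  rw [h1]
  have h6 := mul_besselSlope (-((4 * √x * sin ψ : ℝ) : ℂ) ^ 2 / 4)
  have h7 : -((4 * √x * sin ψ : ℝ) : ℂ) ^ 2 / 4 = ((-4 * x * sin ψ ^ 2 : ℝ) : ℂ) := by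
    rw [← Complex.ofReal_pow, mul_pow, mul_pow, sq_sqrt hx]
    push_cast
    ring
  have h8 : (∫ α in (0)..(2 * π), cos (4 * √x * sin ψ * cos α)) =
      2 * π - 4 * sin ψ ^ 2 * ∫ α in (0)..(2 * π),
        2 * x * cos α ^ 2 * sinc (2 * √x * sin ψ * cos α) ^ 2 := by
    have := continuous_sinc
    rw [← intervalIntegral.integral_const_mul]
    have h9 : (2 * π : ℝ) = ∫ α in (0)..(2 * π), (1 : ℝ) := by simp
    conv_rhs => arg 1; rw [h9]
    rw [← intervalIntegral.integral_sub intervalIntegrable_const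
      (Continuous.intervalIntegrable (by fun_prop) _ _)]
    refine intervalIntegral.integral_congr fun α _ => ?_
    have h10 := one_sub_cos_eq_sinc (4 * √x * sin ψ * cos α)
    rw [show 4 * √x * sin ψ * cos α / 2 = 2 * √x * sin ψ * cos α by ring] at h10
    simp only [mul_pow, sq_sqrt hx] at h10 ⊢
    linarith
  rw [besselGen_neg_sq_div_four, intervalIntegral.integral_ofReal, h8, h7] at h6
  rw [h7]
  refine mul_left_cancel₀ (Complex.ofReal_ne_zero.2 hs) ?_
  rw [mul_left_comm, h6]
  generalize (∫ α in (0)..(2 * π), 2 * x * cos α ^ 2 * sinc (2 * √x * sin ψ * cos α) ^ 2) = J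
  push_cast
  have := pi_pos.ne'
  field_simp
  ring

theorem integral_comp_sin_zero_pi {f : ℝ → ℝ} (hf : Continuous f) :
    ∫ ψ in (0)..π, f (sin ψ) = 2 * ∫ ψ in (0)..(π / 2), f (sin ψ) := by
  have hc : Continuous fun ψ => f (sin ψ) := by fun_prop
  rw [← intervalIntegral.integral_add_adjacent_intervals (hc.intervalIntegrable 0 (π / 2))
    (hc.intervalIntegrable (π / 2) π)]
  have h := intervalIntegral.integral_comp_sub_left (a := π / 2) (b := π)
    (fun ψ => f (sin ψ)) π
  simp only [sin_pi_sub, sub_self, sub_half] at h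
  rw [h]
  ring

theorem besselAvg_ofReal {x : ℝ} (hx : 0 ≤ x) : besselAvg x = besselAvgReal x := by
  have hsc := continuous_sinc
  have h1 : besselAvg x = (π⁻¹ : ℝ) * ∫ ψ in (0)..π, (x : ℂ) *
      besselSlope (x * (1 - circleMap 0 1 (2 * ψ)) ^ 2 / circleMap 0 1 (2 * ψ)) := by
    have h2 := intervalIntegral.integral_comp_mul_left (a := 0) (b := π) (c := 2)
      (fun φ => (x : ℂ) *
        besselSlope (x * (1 - circleMap 0 1 φ) ^ 2 / circleMap 0 1 φ)) two_ne_zero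
    rw [mul_zero] at h2
    rw [h2, besselAvg, circleAverage_def, Complex.real_smul, Complex.real_smul]
    push_cast
    ring
  have h3 : (∫ ψ in (0)..π, (x : ℂ) *
      besselSlope (x * (1 - circleMap 0 1 (2 * ψ)) ^ 2 / circleMap 0 1 (2 * ψ))) =
      ∫ ψ in (0)..π, (((2 * π)⁻¹ * ∫ α in (0)..(2 * π),
        2 * x * cos α ^ 2 * sinc (2 * √x * sin ψ * cos α) ^ 2 : ℝ) : ℂ) := by
    rw [intervalIntegral.integral_of_le pi_pos.le, intervalIntegral.integral_of_le pi_pos.le,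
      integral_Ioc_eq_integral_Ioo, integral_Ioc_eq_integral_Ioo]
    refine setIntegral_congr_fun measurableSet_Ioo fun ψ hψ => ?_
    exact mul_besselSlope_circleMap hx (sin_pos_of_mem_Ioo hψ).ne'
  have h4 : ∫ ψ in (0)..π, ∫ α in (0)..(2 * π),
      2 * x * cos α ^ 2 * sinc (2 * √x * sin ψ * cos α) ^ 2 =
      ∫ α in (0)..(2 * π), ∫ ψ in (0)..π,
        2 * x * cos α ^ 2 * sinc (2 * √x * sin ψ * cos α) ^ 2 :=
    integral_integral_swap_of_continuous (by fun_prop) _ _ _ _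
  have h5 : ∀ α, ∫ ψ in (0)..π, 2 * x * cos α ^ 2 * sinc (2 * √x * sin ψ * cos α) ^ 2 =
      2 * √x * (|cos α| * sincAvg (2 * √x * |cos α|)) := by
    intro α
    rw [integral_comp_sin_zero_pi (f := fun s => 2 * x * cos α ^ 2 * sinc (2 * √x * s * cos α) ^ 2)
      (by fun_prop), sincAvg, ← intervalIntegral.integral_const_mul,
      ← intervalIntegral.integral_const_mul, ← intervalIntegral.integral_const_mul]
    refine intervalIntegral.integral_congr fun ψ _ => ?_
    have h6 : sinc (2 * √x * |cos α| * sin ψ) ^ 2 = sinc (2 * √x * sin ψ * cos α) ^ 2 := by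
      rcases abs_choice (cos α) with h | h <;> rw [h]
      · ring_nf
      · rw [show 2 * √x * -cos α * sin ψ = -(2 * √x * sin ψ * cos α) by ring, sinc_neg]
    simp only [h6]
    rw [← sq_abs (cos α)]
    nth_rewrite 1 [← mul_self_sqrt hx]
    ring
  rw [h1, h3, intervalIntegral.integral_ofReal, intervalIntegral.integral_const_mul, h4,
    ← Complex.ofReal_mul, besselAvgReal]
  simp only [h5]
  rw [intervalIntegral.integral_const_mul]
  congr 1
  field_simp

end RealForm

section Asymptotics

open Real MeasureTheory Set

theorem tendsto_exp_mul_besselAvgReal_sq {γ : ℝ} (hγ : 0 < γ) :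
    Tendsto (fun t : ℝ => exp (-4 * γ * t) * besselAvgReal (t ^ 2) / √t) atTop (nhds 0) := by
  have h := (tendsto_rpow_mul_exp_neg_mul_atTop_nhds_zero (1 / 2) (4 * γ)
    (by positivity)).const_mul 5
  rw [mul_zero] at h
  refine squeeze_zero_norm' ?_ h
  filter_upwards [eventually_gt_atTop 0] with t ht
  have h1 := norm_besselAvgReal_le (t ^ 2)
  rw [sqrt_sq ht.le] at h1
  have h2 := sqrt_pos.2 ht
  rw [norm_div, norm_mul, norm_of_nonneg (exp_pos _).le, norm_of_nonneg h2.le, ← sqrt_eq_rpow,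
    div_le_iff₀ h2, show -4 * γ * t = -(4 * γ) * t by ring]
  calc _ ≤ exp (-(4 * γ) * t) * (5 * t) := by gcongr
    _ = exp (-(4 * γ) * t) * (5 * (√t * √t)) := by rw [mul_self_sqrt ht.le]
    _ = _ := by ring

theorem integrableOn_exp_mul_sqrt {a : ℝ} (ha : 0 < a) :
    IntegrableOn (fun s => exp (-a * s) * √s) (Ioi 0) := by
  have h := integrableOn_rpow_mul_exp_neg_mul_rpow (p := 1) (s := 1 / 2) (b := a)
    (by norm_num) one_pos ha
  simp only [rpow_one, ← sqrt_eq_rpow] at h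
  simpa only [mul_comm] using h

theorem integral_exp_mul_sqrt {a : ℝ} (ha : 0 < a) :
    ∫ s in Ioi (0 : ℝ), exp (-a * s) * √s = √π / (2 * a * √a) := by
  have h := integral_rpow_mul_exp_neg_mul_Ioi (a := 1 / 2 + 1) (by norm_num) ha
  rw [Gamma_add_one (by norm_num), Gamma_one_half_eq, rpow_add_one (by positivity),
    ← sqrt_eq_rpow, sqrt_div zero_le_one, sqrt_one] at h
  simp only [add_sub_cancel_right, ← sqrt_eq_rpow] at h
  simp only [neg_mul, mul_comm (exp _), h]
  field_simp

theorem tendsto_integral_exp_mul_besselAvgReal {γ : ℝ} (hγ : 0 < γ) :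
    Tendsto (fun t : ℝ =>
        4 * γ * (∫ s in (0)..t, exp (-4 * γ * s) * besselAvgReal ((2 * t - s) * s)) / √t) atTop
      (nhds (1 / √(2 * π * γ))) := by
  have hcont := continuous_besselAvgReal
  have h4γ : 0 < 4 * γ := by positivity
  have h : Tendsto (fun t : ℝ => ∫ s in Ioi (0 : ℝ), (Iic t).indicator
      (fun s => exp (-(4 * γ) * s) * (besselAvgReal ((2 * t - s) * s) / √t)) s) atTop
      (nhds (∫ s in Ioi (0 : ℝ), 2 / π * √2 * (exp (-(4 * γ) * s) * √s))) := by
    refine tendsto_integral_filter_of_dominated_convergence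
      (fun s => 5 * √2 * (exp (-(4 * γ) * s) * √s)) ?_ ?_
      ((integrableOn_exp_mul_sqrt h4γ).const_mul _) ?_
    · refine .of_forall fun t => AEStronglyMeasurable.indicator ?_ measurableSet_Iic
      exact Continuous.aestronglyMeasurable (by fun_prop)
    · filter_upwards [eventually_gt_atTop 0] with t ht
      refine (ae_restrict_mem measurableSet_Ioi).mono fun s hs => ?_
      have hs : 0 < s := hs
      refine (norm_indicator_le_norm_self _ _).trans ?_
      have ht' := sqrt_pos.2 ht
      rw [norm_mul, norm_div, norm_of_nonneg (exp_pos _).le, norm_of_nonneg ht'.le, mul_left_comm]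
      refine mul_le_mul_of_nonneg_left ?_ (exp_pos _).le
      rw [div_le_iff₀ ht']
      calc _ ≤ 5 * √((2 * t - s) * s) := norm_besselAvgReal_le _
        _ ≤ 5 * √(2 * s * t) :=
          mul_le_mul_of_nonneg_left (sqrt_le_sqrt (by nlinarith)) (by norm_num)
        _ = _ := by
          rw [sqrt_mul (by positivity), sqrt_mul zero_le_two]
          ring
    · refine (ae_restrict_mem measurableSet_Ioi).mono fun s hs => ?_
      have hs : 0 < s := hs
      have h1 : Tendsto (fun t : ℝ => (2 * t - s) * s) atTop atTop :=
        (tendsto_atTop_add_const_right _ (-s)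
          (tendsto_id.const_mul_atTop two_pos)).atTop_mul_const hs
      have h2 : Tendsto (fun t : ℝ => √((2 - s / t) * s)) atTop (nhds √((2 - 0) * s)) :=
        ((((tendsto_id.const_div_atTop s).const_sub 2).mul_const s)).sqrt
      have h3 := ((tendsto_besselAvgReal_div_sqrt.comp h1).mul h2).const_mul (exp (-(4 * γ) * s))
      rw [sub_zero, sqrt_mul zero_le_two] at h3
      rw [show 2 / π * √2 * (exp (-(4 * γ) * s) * √s) =
        exp (-(4 * γ) * s) * (2 / π * (√2 * √s)) by ring]
      refine h3.congr' ?_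
      filter_upwards [eventually_gt_atTop s] with t ht
      have ht0 : 0 < t := hs.trans ht
      have h4 : 0 < (2 * t - s) * s := mul_pos (by linarith) hs
      rw [indicator_of_mem (mem_Iic.2 ht.le), Function.comp_apply,
        show (2 - s / t) * s = (2 * t - s) * s / t by field_simp, sqrt_div h4.le]
      rw [div_mul_div_comm, mul_comm √_ √t, mul_div_mul_right _ _ (sqrt_pos.2 h4).ne']
  have h' := h.const_mul (4 * γ)
  rw [integral_const_mul, integral_exp_mul_sqrt h4γ] at h'
  have hval : 4 * γ * (2 / π * √2 * (√π / (2 * (4 * γ) * √(4 * γ)))) = 1 / √(2 * π * γ) := by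
    have h1 : √(4 * γ) = 2 * √γ := by
      rw [sqrt_mul (by norm_num), show (4 : ℝ) = 2 ^ 2 by norm_num, sqrt_sq zero_le_two]
    have h2 : √(2 * π * γ) = √2 * √π * √γ := by rw [sqrt_mul (by positivity), sqrt_mul zero_le_two]
    rw [h1, h2]
    have h3 := sq_sqrt pi_pos.le
    have h4 := sq_sqrt (zero_le_two (α := ℝ))
    field_simp
    rw [h3, h4]
  rw [hval] at h'
  refine h'.congr' ?_
  filter_upwards [eventually_gt_atTop 0] with t ht
  rw [setIntegral_indicator measurableSet_Iic, Ioi_inter_Iic,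
    ← intervalIntegral.integral_of_le ht.le, mul_div_assoc, ← intervalIntegral.integral_div]
  simp only [mul_div_assoc, neg_mul]

theorem q1_eq_besselAvgReal {γ r t : ℝ} (hγ : 0 < γ) (hr : 0 < r) (hr1 : r < 1)
    (hr' : r < 1 / (4 + 4 * γ)) (ht : 0 < t) :
    q1 γ r t = ((exp (-4 * γ * t) * besselAvgReal (t ^ 2) +
      4 * γ * ∫ s in (0)..t, exp (-4 * γ * s) * besselAvgReal ((2 * t - s) * s) : ℝ) : ℂ) := by
  rw [q1_eq_besselAvg hγ hr hr1 hr' ht]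
  have h1 : besselAvg ((t : ℂ) ^ 2) = besselAvgReal (t ^ 2) := by
    rw [← Complex.ofReal_pow, besselAvg_ofReal (sq_nonneg t)]
  have h2 : (∫ s in (0)..t, Complex.exp (-4 * γ * s) * besselAvg ((2 * t - s) * s)) =
      ∫ s in (0)..t, ((exp (-4 * γ * s) * besselAvgReal ((2 * t - s) * s) : ℝ) : ℂ) := by
    refine intervalIntegral.integral_congr fun s hs => ?_
    rw [uIcc_of_le ht.le] at hs
    have h3 : 0 ≤ (2 * t - s) * s := mul_nonneg (by linarith [hs.2]) hs.1
    have h4 := besselAvg_ofReal h3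
    push_cast at h4 ⊢
    rw [h4]
  rw [h1, h2, intervalIntegral.integral_ofReal]
  push_cast
  rfl

end Asymptotics

/-- For `γ > 0`, `lim_{t→∞} q1(t)/√t = 1/√(2πγ)`. -/
theorem q1_asymptotics (γ : ℝ) (hγ : 0 < γ) :
    ∃ r0 ∈ Set.Ioo (0 : ℝ) 1, ∀ r ∈ Set.Ioo (0 : ℝ) r0,
      Tendsto (fun t : ℝ => q1 γ r t / (Real.sqrt t : ℂ)) atTop
        (nhds ((1 / Real.sqrt (2 * Real.pi * γ) : ℝ) : ℂ)) := by
  have hr1 : 1 / (4 + 4 * γ) < 1 := by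
    rw [div_lt_one (by positivity)]
    linarith
  refine ⟨1 / (4 + 4 * γ), ⟨by positivity, hr1⟩, fun r hr => ?_⟩
  have h := (tendsto_exp_mul_besselAvgReal_sq hγ).add (tendsto_integral_exp_mul_besselAvgReal hγ)
  rw [zero_add] at h
  refine ((Complex.continuous_ofReal.tendsto _).comp h).congr' ?_
  filter_upwards [eventually_gt_atTop 0] with t ht
  rw [q1_eq_besselAvgReal hγ hr.1 (hr.2.trans hr1) hr.2 ht, ← Complex.ofReal_div, add_div,
    Function.comp_apply]
end

section
/- Fix γ ∈ ℂ and y ∈ ℤ. There is r0 ∈ (0,1) such that for every r ∈ (0,r0): for every (x1,x2) ∈ ℤ², every (a1,a2) ∈ {↑,↓}², and every t ∈ ℝ, the map t ↦ ψ_t(x1,x2;a1,a2) defined in the context is differentiable at t, and i·(d/dt)ψ_t(x1,x2;a1,a2) = (H₂ψ_t)(x1,x2;a1,a2). -/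
/-- Spin index `{↑,↓}`. -/
inductive Spin : Type
  | up : Spin
  | down : Spin
  deriving DecidableEq

/-- `ε(↓,↑) = 1`, `ε(↑,↓) = -1`, `ε(↑,↑) = ε(↓,↓) = 0`. -/
def epsS : Spin → Spin → ℂ
  | Spin.down, Spin.up => 1
  | Spin.up, Spin.down => -1
  | _, _ => 0

/-- `s(z) = (z - 1/z)/(2i)`. -/
noncomputable def sfun (z : ℂ) : ℂ := (z - z⁻¹) / (2 * Complex.I)

/-- `θ = -(s(z1)-s(z2)+2γ)/(s(z1)-s(z2)-2γ)`. -/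
noncomputable def theta (γ z1 z2 : ℂ) : ℂ :=
  -((sfun z1 - sfun z2 + 2 * γ) / (sfun z1 - sfun z2 - 2 * γ))

/-- The two-particle Bethe wave function `φ(x1,x2;a1,a2|z1,z2)`. -/
noncomputable def phi (γ z1 z2 : ℂ) (x1 x2 : ℤ) (a1 a2 : Spin) : ℂ :=
  if x1 ≤ x2 then
    (1 / 2) * epsS a1 a2 * (z1 ^ x1 * z2 ^ x2 - theta γ z1 z2 * (z2 ^ x1 * z1 ^ x2))
  else
    (1 / 2) * epsS a1 a2 * (z1 ^ x2 * z2 ^ x1 - theta γ z1 z2 * (z1 ^ x1 * z2 ^ x2))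

/-- The two-particle Hubbard operator with imaginary interaction `H₂`. -/
noncomputable def Ham2 (γ : ℂ) (ψ : ℤ → ℤ → Spin → Spin → ℂ) (x1 x2 : ℤ) (a1 a2 : Spin) : ℂ :=
  -(ψ (x1 + 1) x2 a1 a2 + ψ (x1 - 1) x2 a1 a2 + ψ x1 (x2 + 1) a1 a2 + ψ x1 (x2 - 1) a1 a2) +
    4 * Complex.I * γ * ((if x1 = x2 then 1 else 0) - 1) * ψ x1 x2 a1 a2

/-- `E(z1,z2) = -(z1 + 1/z1) - (z2 + 1/z2) - 4iγ`. -/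
noncomputable def En (γ z1 z2 : ℂ) : ℂ := -(z1 + z1⁻¹) - (z2 + z2⁻¹) - 4 * Complex.I * γ

/-- The contour-integral formula `ψ_t(x1,x2;a1,a2)`. -/
noncomputable def psi (γ : ℂ) (y : ℤ) (r : ℝ) (t : ℝ) (x1 x2 : ℤ) (a1 a2 : Spin) : ℂ :=
  cint r fun z1 => cint 1 fun z2 =>
    (z1 * z2) ^ (-y) * Complex.exp (-Complex.I * En γ z1 z2 * t) * phi γ z1 z2 x1 x2 a1 a2

/-- Differentiation under the integral sign for a jointly continuous derivative. -/
theorem hasDerivAt_intervalIntegral_of_continuous {F F' : ℝ → ℝ → ℂ} {a b : ℝ}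
    (hF : Continuous (Function.uncurry F)) (hF' : Continuous (Function.uncurry F'))
    (h : ∀ t u, HasDerivAt (fun τ => F τ u) (F' t u) t) (t : ℝ) :
    HasDerivAt (fun τ => ∫ u in a..b, F τ u) (∫ u in a..b, F' t u) t := by
  have hK : IsCompact (Metric.closedBall t 1 ×ˢ Set.uIcc a b) :=
    (isCompact_closedBall t 1).prod isCompact_uIcc
  obtain ⟨C, hC⟩ := hK.exists_bound_of_continuousOn hF'.continuousOn
  refine (intervalIntegral.hasDerivAt_integral_of_dominated_loc_of_deriv_le (bound := fun _ => C)
    (Metric.ball_mem_nhds t one_pos) (Filter.Eventually.of_forall fun τ => ?_) ?_ ?_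
    (Filter.Eventually.of_forall fun u hu τ hτ => ?_) ?_
    (Filter.Eventually.of_forall fun u _ τ _ => h τ u)).2
  · exact (hF.comp (by fun_prop : Continuous fun u => (τ, u))).aestronglyMeasurable
  · exact (hF.comp (by fun_prop : Continuous fun u => (t, u))).intervalIntegrable _ _
  · exact (hF'.comp (by fun_prop : Continuous fun u => (t, u))).aestronglyMeasurable
  · exact hC (τ, u) ⟨Metric.ball_subset_closedBall hτ, Set.uIoc_subset_uIcc hu⟩
  · exact intervalIntegrable_const

/-- The normalized contour integral is an average over the angle. -/
theorem cint_eq_intervalIntegral {ρ : ℝ} (hρ : ρ ≠ 0) (f : ℂ → ℂ) :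
    cint ρ f = (2 * Real.pi : ℂ)⁻¹ * ∫ u in (0 : ℝ)..2 * Real.pi, f (circleMap 0 ρ u) := by
  have h : (∮ z in C(0, ρ), f z / z) =
      Complex.I * ∫ u in (0 : ℝ)..2 * Real.pi, f (circleMap 0 ρ u) := by
    rw [circleIntegral, ← intervalIntegral.integral_const_mul]
    refine intervalIntegral.integral_congr fun u _ => ?_
    have hz : circleMap 0 ρ u ≠ 0 := circleMap_ne_center hρ
    simp only [deriv_circleMap, smul_eq_mul]
    field_simp
  rw [cint, h]
  have := Complex.I_ne_zero
  field_simp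

/-- The average over the torus of radii `r` and `1`. -/
noncomputable def torusAverage (G : ℝ → ℝ → ℂ) : ℂ :=
  (2 * Real.pi : ℂ)⁻¹ * ∫ u in (0 : ℝ)..2 * Real.pi,
    (2 * Real.pi : ℂ)⁻¹ * ∫ v in (0 : ℝ)..2 * Real.pi, G u v

theorem continuous_integral_right {G : ℝ → ℝ → ℂ} (hG : Continuous (Function.uncurry G)) (a b : ℝ) :
    Continuous fun u => ∫ v in a..b, G u v :=
  intervalIntegral.continuous_parametric_intervalIntegral_of_continuous' hG a b

theorem torusAverage_add {G H : ℝ → ℝ → ℂ} (hG : Continuous (Function.uncurry G))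
    (hH : Continuous (Function.uncurry H)) :
    torusAverage (fun u v => G u v + H u v) = torusAverage G + torusAverage H := by
  have hu (K : ℝ → ℝ → ℂ) (hK : Continuous (Function.uncurry K)) (u : ℝ) : Continuous (K u) :=
    hK.comp (by fun_prop : Continuous fun v => (u, v))
  simp only [torusAverage, intervalIntegral.integral_const_mul]
  rw [← mul_add, ← mul_add, ← intervalIntegral.integral_add
    ((continuous_integral_right hG _ _).intervalIntegrable _ _)
    ((continuous_integral_right hH _ _).intervalIntegrable _ _)]
  congr 3
  ext u
  exact intervalIntegral.integral_add ((hu G hG u).intervalIntegrable _ _)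
    ((hu H hH u).intervalIntegrable _ _)

theorem torusAverage_const_mul (c : ℂ) (G : ℝ → ℝ → ℂ) :
    torusAverage (fun u v => c * G u v) = c * torusAverage G := by
  simp only [torusAverage, intervalIntegral.integral_const_mul]
  ring

theorem hasDerivAt_torusAverage {F F' : ℝ → ℝ → ℝ → ℂ}
    (hF : Continuous fun p : ℝ × ℝ × ℝ => F p.1 p.2.1 p.2.2)
    (hF' : Continuous fun p : ℝ × ℝ × ℝ => F' p.1 p.2.1 p.2.2)
    (h : ∀ t u v, HasDerivAt (fun τ => F τ u v) (F' t u v) t) (t : ℝ) :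
    HasDerivAt (fun τ => torusAverage (F τ)) (torusAverage (F' t)) t := by
  have hc (K : ℝ → ℝ → ℝ → ℂ) (hK : Continuous fun p : ℝ × ℝ × ℝ => K p.1 p.2.1 p.2.2) :
      Continuous (Function.uncurry fun τ u =>
        (2 * Real.pi : ℂ)⁻¹ * ∫ v in (0 : ℝ)..2 * Real.pi, K τ u v) := by
    refine continuous_const.mul ?_
    refine intervalIntegral.continuous_parametric_intervalIntegral_of_continuous'
      (f := fun (p : ℝ × ℝ) v => K p.1 p.2 v) ?_ _ _
    exact hK.comp (by fun_prop : Continuous fun q : (ℝ × ℝ) × ℝ => (q.1.1, q.1.2, q.2))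
  refine (hasDerivAt_intervalIntegral_of_continuous (hc F hF) (hc F' hF') (fun s u => ?_) t).const_mul _
  refine (hasDerivAt_intervalIntegral_of_continuous ?_ ?_ (fun s v => h s u v) s).const_mul _
  · exact hF.comp (by fun_prop : Continuous fun q : ℝ × ℝ => (q.1, u, q.2))
  · exact hF'.comp (by fun_prop : Continuous fun q : ℝ × ℝ => (q.1, u, q.2))

/-- The Bethe wave function is an eigenfunction of the Hamiltonian. -/
theorem Ham2_phi {γ z1 z2 : ℂ} (h1 : z1 ≠ 0) (h2 : z2 ≠ 0)
    (hs : sfun z1 - sfun z2 - 2 * γ ≠ 0) (x1 x2 : ℤ) (a1 a2 : Spin) :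
    Ham2 γ (phi γ z1 z2) x1 x2 a1 a2 = En γ z1 z2 * phi γ z1 z2 x1 x2 a1 a2 := by
  have hθ : theta γ z1 z2 * (sfun z1 - sfun z2 - 2 * γ) = -(sfun z1 - sfun z2 + 2 * γ) := by
    rw [theta, neg_mul, div_mul_cancel₀ _ hs]
  have hsf (z : ℂ) : z - z⁻¹ = 2 * Complex.I * sfun z := by
    have := Complex.I_ne_zero
    rw [sfun]; field_simp
  have e1 := hsf z1
  have e2 := hsf z2
  rcases lt_trichotomy x1 x2 with h | h | h
  · simp only [Ham2, phi, En, if_pos (by lia : x1 + 1 ≤ x2), if_pos (by lia : x1 - 1 ≤ x2),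
      if_pos (by lia : x1 ≤ x2 + 1), if_pos (by lia : x1 ≤ x2 - 1), if_pos h.le, if_neg h.ne,
      zpow_add_one₀ h1, zpow_add_one₀ h2, zpow_sub_one₀ h1, zpow_sub_one₀ h2]
    ring
  · subst h
    simp only [Ham2, phi, En, if_neg (by lia : ¬ x1 + 1 ≤ x1), if_pos (by lia : x1 - 1 ≤ x1),
      if_pos (by lia : x1 ≤ x1 + 1), if_neg (by lia : ¬ x1 ≤ x1 - 1), le_refl, if_true,
      zpow_add_one₀ h1, zpow_add_one₀ h2, zpow_sub_one₀ h1, zpow_sub_one₀ h2]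
    linear_combination (1 / 2 * epsS a1 a2 * (z1 ^ x1 * z2 ^ x1)) *
      (2 * Complex.I * hθ + (1 + theta γ z1 z2) * e1 - (1 + theta γ z1 z2) * e2)
  · have hsym (y1 y2 : ℤ) (hy : y2 ≤ y1) : phi γ z1 z2 y1 y2 a1 a2 =
        1 / 2 * epsS a1 a2 *
          (z1 ^ y2 * z2 ^ y1 - theta γ z1 z2 * (z1 ^ y1 * z2 ^ y2)) := by
      rcases hy.eq_or_lt with rfl | hy
      · simp only [phi, le_refl, if_true]
        ring
      · rw [phi, if_neg hy.not_ge]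
    simp only [Ham2, En, hsym (x1 + 1) x2 (by lia), hsym (x1 - 1) x2 (by lia),
      hsym x1 (x2 + 1) (by lia), hsym x1 (x2 - 1) (by lia), hsym x1 x2 h.le, if_neg h.ne',
      zpow_add_one₀ h1, zpow_add_one₀ h2, zpow_sub_one₀ h1, zpow_sub_one₀ h2]
    ring

theorem sfun_sub_ne {γ z1 z2 : ℂ} (h1 : ‖z1‖ < (4 + 4 * ‖γ‖)⁻¹) (h0 : z1 ≠ 0) (h2 : ‖z2‖ = 1) :
    sfun z1 - sfun z2 - 2 * γ ≠ 0 := by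
  intro h
  have hI := Complex.I_ne_zero
  have h3 : z1⁻¹ = z1 - (z2 - z2⁻¹) - 4 * Complex.I * γ := by
    have : (sfun z1 - sfun z2 - 2 * γ) * (2 * Complex.I) =
        z1 - z1⁻¹ - (z2 - z2⁻¹) - 4 * Complex.I * γ := by
      rw [sfun, sfun]; field_simp; ring
    rw [h, zero_mul] at this
    linear_combination this
  have h4 : ‖z1⁻¹‖ ≤ ‖z1‖ + (‖z2‖ + ‖z2⁻¹‖) + 4 * ‖γ‖ := by
    rw [h3]
    refine (norm_sub_le _ _).trans (add_le_add ((norm_sub_le _ _).trans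
      (add_le_add_right (norm_sub_le _ _) _)) ?_)
    simp
  have hp : 0 < ‖z1‖ := norm_pos_iff.2 h0
  have hb : 4 + 4 * ‖γ‖ < ‖z1‖⁻¹ := (lt_inv_comm₀ hp (by positivity)).1 h1
  have h5 : ‖z1‖ < 1 := h1.trans_le (inv_le_one_of_one_le₀ (by linarith [norm_nonneg γ]))
  rw [norm_inv, norm_inv, h2] at h4
  norm_num at h4
  linarith

/-- The integrand of `psi` on the torus, in terms of the angles. -/
noncomputable def torusIntegrand (γ : ℂ) (y : ℤ) (r : ℝ) (a1 a2 : Spin) (x1 x2 : ℤ)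
    (τ u v : ℝ) : ℂ :=
  (circleMap 0 r u * circleMap 0 1 v) ^ (-y) *
    Complex.exp (-Complex.I * En γ (circleMap 0 r u) (circleMap 0 1 v) * τ) *
    phi γ (circleMap 0 r u) (circleMap 0 1 v) x1 x2 a1 a2

theorem psi_eq_torusAverage (γ : ℂ) (y : ℤ) {r : ℝ} (hr : r ≠ 0) (a1 a2 : Spin) (x1 x2 : ℤ)
    (τ : ℝ) :
    psi γ y r τ x1 x2 a1 a2 = torusAverage (torusIntegrand γ y r a1 a2 x1 x2 τ) := by
  simp only [psi, cint_eq_intervalIntegral hr, cint_eq_intervalIntegral one_ne_zero,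
    torusAverage, torusIntegrand]

theorem Continuous.En {X : Type*} [TopologicalSpace X] (γ : ℂ) {f g : X → ℂ}
    (hf : Continuous f) (hg : Continuous g) (hf0 : ∀ x, f x ≠ 0) (hg0 : ∀ x, g x ≠ 0) :
    Continuous fun x => En γ (f x) (g x) :=
  ((hf.add (hf.inv₀ hf0)).neg.sub (hg.add (hg.inv₀ hg0))).sub continuous_const

theorem Continuous.phi {X : Type*} [TopologicalSpace X] {γ : ℂ} {f g : X → ℂ}
    (hf : Continuous f) (hg : Continuous g) (hf0 : ∀ x, f x ≠ 0) (hg0 : ∀ x, g x ≠ 0)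
    (hs : ∀ x, sfun (f x) - sfun (g x) - 2 * γ ≠ 0) (x1 x2 : ℤ) (a1 a2 : Spin) :
    Continuous fun x => phi γ (f x) (g x) x1 x2 a1 a2 := by
  have hfp (n : ℤ) : Continuous fun x => f x ^ n := hf.zpow₀ n fun x => Or.inl (hf0 x)
  have hgp (n : ℤ) : Continuous fun x => g x ^ n := hg.zpow₀ n fun x => Or.inl (hg0 x)
  have hS : Continuous fun x => sfun (f x) - sfun (g x) :=
    ((hf.sub (hf.inv₀ hf0)).div_const _).sub ((hg.sub (hg.inv₀ hg0)).div_const _)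
  have hθ : Continuous fun x => theta γ (f x) (g x) :=
    ((hS.add continuous_const).div (hS.sub continuous_const) hs).neg
  unfold _root_.phi
  split_ifs
  · exact continuous_const.mul (((hfp _).mul (hgp _)).sub (hθ.mul ((hgp _).mul (hfp _))))
  · exact continuous_const.mul (((hfp _).mul (hgp _)).sub (hθ.mul ((hfp _).mul (hgp _))))

theorem continuous_En_circleMap (γ : ℂ) {r : ℝ} (hr : r ≠ 0) :
    Continuous fun p : ℝ × ℝ × ℝ => En γ (circleMap 0 r p.2.1) (circleMap 0 1 p.2.2) :=
  Continuous.En γ ((continuous_circleMap 0 r).comp (by fun_prop))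
    ((continuous_circleMap 0 1).comp (by fun_prop)) (fun _ => circleMap_ne_center hr)
    fun _ => circleMap_ne_center one_ne_zero

theorem continuous_torusIntegrand {γ : ℂ} (y : ℤ) {r : ℝ} (hr : r ≠ 0)
    (hs : ∀ u v, sfun (circleMap 0 r u) - sfun (circleMap 0 1 v) - 2 * γ ≠ 0)
    (a1 a2 : Spin) (x1 x2 : ℤ) :
    Continuous fun p : ℝ × ℝ × ℝ => torusIntegrand γ y r a1 a2 x1 x2 p.1 p.2.1 p.2.2 := by
  have hz (p : ℝ × ℝ × ℝ) : circleMap 0 r p.2.1 ≠ 0 := circleMap_ne_center hr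
  have hw (p : ℝ × ℝ × ℝ) : circleMap 0 1 p.2.2 ≠ 0 := circleMap_ne_center one_ne_zero
  have hZ : Continuous fun p : ℝ × ℝ × ℝ => circleMap 0 r p.2.1 :=
    (continuous_circleMap 0 r).comp (by fun_prop)
  have hW : Continuous fun p : ℝ × ℝ × ℝ => circleMap 0 1 p.2.2 :=
    (continuous_circleMap 0 1).comp (by fun_prop)
  have hE := continuous_En_circleMap γ hr
  unfold torusIntegrand
  refine Continuous.mul (Continuous.mul ?_ ?_)
    (hZ.phi hW hz hw (fun p => hs p.2.1 p.2.2) x1 x2 a1 a2)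
  · exact (hZ.mul hW).zpow₀ _ fun p => Or.inl (mul_ne_zero (hz p) (hw p))
  · exact ((continuous_const.mul hE).mul (Complex.continuous_ofReal.comp continuous_fst)).cexp

theorem hasDerivAt_torusIntegrand (γ : ℂ) (y : ℤ) (r : ℝ) (a1 a2 : Spin) (x1 x2 : ℤ)
    (t u v : ℝ) :
    HasDerivAt (fun τ => torusIntegrand γ y r a1 a2 x1 x2 τ u v)
      (-Complex.I * (En γ (circleMap 0 r u) (circleMap 0 1 v) *
        torusIntegrand γ y r a1 a2 x1 x2 t u v)) t := by
  unfold torusIntegrand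
  generalize circleMap 0 r u = z
  generalize circleMap 0 1 v = w
  have h1 : HasDerivAt (fun τ : ℝ => -Complex.I * En γ z w * (τ : ℂ))
      (-Complex.I * En γ z w * 1) t :=
    (Complex.ofRealCLM.hasDerivAt).const_mul _
  refine ((h1.cexp.const_mul ((z * w) ^ (-y))).mul_const (phi γ z w x1 x2 a1 a2)).congr_deriv ?_
  ring

theorem En_mul_torusIntegrand {γ : ℂ} (y : ℤ) {r : ℝ} (hr : r ≠ 0)
    (hs : ∀ u v, sfun (circleMap 0 r u) - sfun (circleMap 0 1 v) - 2 * γ ≠ 0)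
    (a1 a2 : Spin) (x1 x2 : ℤ) (t u v : ℝ) :
    En γ (circleMap 0 r u) (circleMap 0 1 v) * torusIntegrand γ y r a1 a2 x1 x2 t u v =
      Ham2 γ (fun x1 x2 a1 a2 => torusIntegrand γ y r a1 a2 x1 x2 t u v) x1 x2 a1 a2 := by
  have h := Ham2_phi (circleMap_ne_center hr) (circleMap_ne_center one_ne_zero)
    (hs u v) x1 x2 a1 a2
  simp only [Ham2, torusIntegrand] at h ⊢
  generalize circleMap 0 r u = z at h ⊢
  generalize circleMap 0 1 v = w at h ⊢
  linear_combination (-((z * w) ^ (-y) * Complex.exp (-Complex.I * En γ z w * t))) * h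

theorem continuous_uncurry_add {G H : ℝ → ℝ → ℂ} (hG : Continuous (Function.uncurry G))
    (hH : Continuous (Function.uncurry H)) :
    Continuous (Function.uncurry fun u v => G u v + H u v) :=
  hG.add hH

theorem continuous_uncurry_const_mul (c : ℂ) {G : ℝ → ℝ → ℂ}
    (hG : Continuous (Function.uncurry G)) :
    Continuous (Function.uncurry fun u v => c * G u v) :=
  continuous_const.mul hG

theorem continuous_uncurry_slice {F : ℝ → ℝ → ℝ → ℂ}
    (hF : Continuous fun p : ℝ × ℝ × ℝ => F p.1 p.2.1 p.2.2) (t : ℝ) :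
    Continuous (Function.uncurry (F t)) :=
  hF.comp (Continuous.prodMk_right t)

theorem torusAverage_Ham2 (γ : ℂ) {G : ℤ → ℤ → Spin → Spin → ℝ → ℝ → ℂ}
    (hG : ∀ x1 x2 a1 a2, Continuous (Function.uncurry (G x1 x2 a1 a2)))
    (x1 x2 : ℤ) (a1 a2 : Spin) :
    torusAverage (fun u v => Ham2 γ (fun x1 x2 a1 a2 => G x1 x2 a1 a2 u v) x1 x2 a1 a2) =
      Ham2 γ (fun x1 x2 a1 a2 => torusAverage (G x1 x2 a1 a2)) x1 x2 a1 a2 := by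
  have h1 := continuous_uncurry_add (hG (x1 + 1) x2 a1 a2) (hG (x1 - 1) x2 a1 a2)
  have h2 := continuous_uncurry_add h1 (hG x1 (x2 + 1) a1 a2)
  have h3 := continuous_uncurry_add h2 (hG x1 (x2 - 1) a1 a2)
  simp only [Ham2, neg_eq_neg_one_mul (_ + _ : ℂ)]
  rw [torusAverage_add (continuous_uncurry_const_mul _ h3)
      (continuous_uncurry_const_mul _ (hG x1 x2 a1 a2)),
    torusAverage_const_mul, torusAverage_const_mul, torusAverage_add h2 (hG _ _ _ _),
    torusAverage_add h1 (hG _ _ _ _), torusAverage_add (hG _ _ _ _) (hG _ _ _ _)]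

/-- For fixed `γ ∈ ℂ`, `y ∈ ℤ` and small enough contour radius, `t ↦ ψ_t(x1,x2;a1,a2)` is
differentiable and satisfies `i·(d/dt)ψ_t = H₂ψ_t`. -/
theorem psi_solves_schrodinger (γ : ℂ) (y : ℤ) :
    ∃ r0 ∈ Set.Ioo (0 : ℝ) 1, ∀ r ∈ Set.Ioo (0 : ℝ) r0,
      ∀ (x1 x2 : ℤ) (a1 a2 : Spin) (t : ℝ),
        DifferentiableAt ℝ (fun τ : ℝ => psi γ y r τ x1 x2 a1 a2) t ∧
        Complex.I * deriv (fun τ : ℝ => psi γ y r τ x1 x2 a1 a2) t =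
          Ham2 γ (fun x1 x2 a1 a2 => psi γ y r t x1 x2 a1 a2) x1 x2 a1 a2 := by
  refine ⟨(4 + 4 * ‖γ‖)⁻¹, ⟨by positivity, inv_lt_one_of_one_lt₀ (by linarith [norm_nonneg γ])⟩, ?_⟩
  intro r hr' x1 x2 a1 a2 t
  have hr : 0 < r := hr'.1
  have hr0 : r < (4 + 4 * ‖γ‖)⁻¹ := hr'.2
  have hs (u v : ℝ) : sfun (circleMap 0 r u) - sfun (circleMap 0 1 v) - 2 * γ ≠ 0 :=
    sfun_sub_ne (by simpa [abs_of_pos hr] using hr0) (circleMap_ne_center hr.ne') (by simp)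
  have hF := continuous_torusIntegrand y hr.ne' hs
  simp only [psi_eq_torusAverage γ y hr.ne']
  have hd := hasDerivAt_torusAverage (hF a1 a2 x1 x2)
    (F' := fun τ u v => -Complex.I * (En γ (circleMap 0 r u) (circleMap 0 1 v) *
      torusIntegrand γ y r a1 a2 x1 x2 τ u v))
    (continuous_const.mul ((continuous_En_circleMap γ hr.ne').mul (hF a1 a2 x1 x2)))
    (hasDerivAt_torusIntegrand γ y r a1 a2 x1 x2) t
  refine ⟨hd.differentiableAt, ?_⟩
  rw [hd.deriv, torusAverage_const_mul, ← mul_assoc, mul_neg, Complex.I_mul_I, neg_neg, one_mul]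
  simp only [En_mul_torusIntegrand y hr.ne' hs]
  have hFt (x1 x2 : ℤ) (a1 a2 : Spin) :
      Continuous (Function.uncurry (torusIntegrand γ y r a1 a2 x1 x2 t)) :=
    continuous_uncurry_slice (F := torusIntegrand γ y r a1 a2 x1 x2) (hF a1 a2 x1 x2) t
  exact torusAverage_Ham2 γ hFt x1 x2 a1 a2
end

section
/- Fix γ ∈ ℂ and z1,z2 ∈ ℂ∖{0} with s(z1) − s(z2) ≠ 2γ. Then the two-particle Bethe wave function φ(·,·;·,·|z1,z2) is an eigenfunction of the two-particle Hubbard operator with imaginary interaction: for every (x1,x2) ∈ ℤ² and every (a1,a2) ∈ {↑,↓}², (H₂φ(·,·;·,·|z1,z2))(x1,x2;a1,a2) = E(z1,z2)·φ(x1,x2;a1,a2|z1,z2). -/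
theorem phi_of_le (γ z1 z2 : ℂ) {x1 x2 : ℤ} (h : x1 ≤ x2) (a1 a2 : Spin) :
    phi γ z1 z2 x1 x2 a1 a2 =
      (1 / 2) * epsS a1 a2 * (z1 ^ x1 * z2 ^ x2 - theta γ z1 z2 * (z2 ^ x1 * z1 ^ x2)) :=
  if_pos h

/-- The second branch of the wave function also holds on the diagonal. -/
theorem phi_of_ge (γ z1 z2 : ℂ) {x1 x2 : ℤ} (h : x2 ≤ x1) (a1 a2 : Spin) :
    phi γ z1 z2 x1 x2 a1 a2 =
      (1 / 2) * epsS a1 a2 * (z1 ^ x2 * z2 ^ x1 - theta γ z1 z2 * (z1 ^ x1 * z2 ^ x2)) := by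
  rcases h.eq_or_lt with rfl | h
  · rw [phi_of_le _ _ _ le_rfl, mul_comm (z2 ^ x2)]
  · exact if_neg h.not_ge

/-- The boundary condition on the diagonal that determines `theta`. -/
theorem theta_mul_eq {γ z1 z2 : ℂ} (hs : sfun z1 - sfun z2 ≠ 2 * γ) :
    theta γ z1 z2 * (z1 - z1⁻¹ - (z2 - z2⁻¹) - 4 * Complex.I * γ) =
      -(z1 - z1⁻¹ - (z2 - z2⁻¹) + 4 * Complex.I * γ) := by
  have hsfun (z : ℂ) : z - z⁻¹ = 2 * Complex.I * sfun z := by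
    rw [sfun, mul_div_cancel₀ _ (mul_ne_zero two_ne_zero Complex.I_ne_zero)]
  have hθ : theta γ z1 z2 * (sfun z1 - sfun z2 - 2 * γ) = -(sfun z1 - sfun z2 + 2 * γ) := by
    rw [theta, neg_mul, div_mul_cancel₀ _ (sub_ne_zero.2 hs)]
  rw [hsfun, hsfun]
  linear_combination 2 * Complex.I * hθ

/-- The two-particle Bethe wave function `φ(·,·;·,·|z1,z2)` is an eigenfunction of the
two-particle Hubbard operator with imaginary interaction, with eigenvalue `E(z1,z2)`. -/
theorem phi_eigenfunction (γ z1 z2 : ℂ) (hz1 : z1 ≠ 0) (hz2 : z2 ≠ 0)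
    (hs : sfun z1 - sfun z2 ≠ 2 * γ) :
    ∀ (x1 x2 : ℤ) (a1 a2 : Spin),
      Ham2 γ (phi γ z1 z2) x1 x2 a1 a2 = En γ z1 z2 * phi γ z1 z2 x1 x2 a1 a2 := by
  intro x1 x2 a1 a2
  rcases lt_trichotomy x1 x2 with h | rfl | h
  · rw [Ham2, if_neg h.ne, phi_of_le _ _ _ (by lia : x1 + 1 ≤ x2),
      phi_of_le _ _ _ (by lia : x1 - 1 ≤ x2), phi_of_le _ _ _ (by lia : x1 ≤ x2 + 1),
      phi_of_le _ _ _ (by lia : x1 ≤ x2 - 1), phi_of_le _ _ _ h.le, En]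
    simp only [zpow_add_one₀ hz1, zpow_add_one₀ hz2, zpow_sub_one₀ hz1, zpow_sub_one₀ hz2]
    ring
  · rw [Ham2, if_pos rfl, phi_of_ge _ _ _ (by lia : x1 ≤ x1 + 1),
      phi_of_le _ _ _ (by lia : x1 - 1 ≤ x1), phi_of_le _ _ _ (by lia : x1 ≤ x1 + 1),
      phi_of_ge _ _ _ (by lia : x1 - 1 ≤ x1), phi_of_le _ _ _ le_rfl, En]
    simp only [zpow_add_one₀ hz1, zpow_add_one₀ hz2, zpow_sub_one₀ hz1, zpow_sub_one₀ hz2]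
    linear_combination (1 / 2) * epsS a1 a2 * z1 ^ x1 * z2 ^ x1 * theta_mul_eq hs
  · rw [Ham2, if_neg h.ne', phi_of_ge _ _ _ (by lia : x2 ≤ x1 + 1),
      phi_of_ge _ _ _ (by lia : x2 ≤ x1 - 1), phi_of_ge _ _ _ (by lia : x2 + 1 ≤ x1),
      phi_of_ge _ _ _ (by lia : x2 - 1 ≤ x1), phi_of_ge _ _ _ h.le, En]
    simp only [zpow_add_one₀ hz1, zpow_add_one₀ hz2, zpow_sub_one₀ hz1, zpow_sub_one₀ hz2]
    ring
end

section
/- Let γ ∈ ℂ. There is r0 ∈ (0,1) such that for every r ∈ (0,r0), all integers y1 < y2 and x1 ≤ x2 ≤ x3 ≤ x4 with x1 < x3, and every a ∈ {↑,↓}⁴: ∮_{|z1|=r³} ∮_{|z2|=r²} ∮_{|z3|=r} ∮_{|z4|=1} [Y_{2,3}(s(z1)−s(z4)) I4](a) · (s(z1)−s(z2))/(s(z1)−s(z2)−2γ) · (s(z3)−s(z4))/(s(z3)−s(z4)−2γ) · z2^{x1−y1} z4^{x2−y2} z1^{x3−y1} z3^{x4−y2} dz4/(2πiz4) dz3/(2πiz3)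 dz2/(2πiz2) dz1/(2πiz1) = 0. -/
/-- `(ℂ²)^{⊗4}`, identified with functions `{↑,↓}⁴ → ℂ`. -/
abbrev V4 : Type := (Fin 4 → Spin) → ℂ

/-- The transposition operator `Π_{j,l}` acting on `(ℂ²)^{⊗4}`. -/
def Pi4 (j l : Fin 4) (w : V4) : V4 := fun a => w (a ∘ Equiv.swap j l)

/-- The Yang operator `Y_{j,l}(λ) = (λΠ_{j,l} - 2γ·Id)/(λ - 2γ)` on `(ℂ²)^{⊗4}`. -/
noncomputable def Y4 (γ : ℂ) (j l : Fin 4) (lam : ℂ) (w : V4) : V4 :=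
  fun a => (lam * Pi4 j l w a - 2 * γ * w a) / (lam - 2 * γ)

/-- The vector `I4` with components `I4(a1,a2,a3,a4) = ε(a1,a2)·ε(a3,a4)`. -/
def I4 : V4 := fun a => epsS (a 0) (a 1) * epsS (a 2) (a 3)

section NormalizedCircleIntegral

open Metric Complex

theorem cint_eq_integral {ρ : ℝ} (hρ : ρ ≠ 0) (f : ℂ → ℂ) :
    cint ρ f = (2 * Real.pi)⁻¹ • ∫ θ in 0..2 * Real.pi, f (circleMap 0 ρ θ) := by
  rw [← Real.circleAverage_def, Real.circleAverage_eq_circleIntegral hρ]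
  simp [cint, div_eq_inv_mul]

theorem cint_congr {ρ : ℝ} (hρ : 0 ≤ ρ) {f g : ℂ → ℂ} (h : ∀ z, ‖z‖ = ρ → f z = g z) :
    cint ρ f = cint ρ g := by
  unfold cint
  rw [circleIntegral.integral_congr hρ fun z hz => by rw [h z (by simpa using hz)]]

theorem cint_const_mul (ρ : ℝ) (f : ℂ → ℂ) (b : ℂ) :
    cint ρ (fun z => b * f z) = b * cint ρ f := by
  unfold cint
  simp only [mul_div_assoc, circleIntegral.integral_const_mul]
  ring

theorem cint_mul_const (ρ : ℝ) (f : ℂ → ℂ) (b : ℂ) :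
    cint ρ (fun z => f z * b) = cint ρ f * b := by
  simp only [mul_comm _ b, cint_const_mul]

theorem cint_add_const_mul {ρ : ℝ} (hρ : 0 < ρ) {f g : ℂ → ℂ} (hf : ContinuousOn f (sphere 0 ρ))
    (hg : ContinuousOn g (sphere 0 ρ)) (b : ℂ) :
    cint ρ (fun z => f z + b * g z) = cint ρ f + b * cint ρ g := by
  have h0 : ∀ z ∈ sphere (0 : ℂ) ρ, z ≠ 0 := fun z hz => ne_of_mem_sphere hz hρ.ne'
  rw [← cint_const_mul]
  unfold cint
  simp only [add_div]
  rw [circleIntegral.integral_add, mul_add]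
  · exact (hf.div continuousOn_id h0).circleIntegrable hρ.le
  · exact ((continuousOn_const.mul hg).div continuousOn_id h0).circleIntegrable hρ.le

theorem continuous_cint {X : Type*} [TopologicalSpace X] {σ : ℝ} (hσ : σ ≠ 0) {F : X → ℂ → ℂ}
    (hF : Continuous fun p : X × ℝ => F p.1 (circleMap 0 σ p.2)) :
    Continuous fun x => cint σ (F x) := by
  simp only [cint_eq_integral hσ]
  exact (intervalIntegral.continuous_parametric_intervalIntegral_of_continuous'
    (μ := MeasureTheory.volume) (f := fun x θ => F x (circleMap 0 σ θ)) hF _ _).const_smul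
      (2 * Real.pi)⁻¹

/-- An iterated integral vanishes if the integral over the outer variable does. -/
theorem cint_cint_eq_zero {ρ σ : ℝ} (hρ : ρ ≠ 0) (hσ : σ ≠ 0) {F : ℂ → ℂ → ℂ}
    (hF : Continuous fun p : ℝ × ℝ => F (circleMap 0 ρ p.1) (circleMap 0 σ p.2))
    (h : ∀ θ, cint ρ (fun z => F z (circleMap 0 σ θ)) = 0) :
    cint ρ (fun z => cint σ (F z)) = 0 := by
  have h' : ∀ θ, ∫ t in 0..2 * Real.pi, F (circleMap 0 ρ t) (circleMap 0 σ θ) = 0 := by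
    intro θ
    have := h θ
    rw [cint_eq_integral hρ] at this
    simpa [Real.pi_ne_zero] using this
  rw [cint_eq_integral hρ]
  simp only [cint_eq_integral hσ]
  rw [intervalIntegral.integral_smul, MeasureTheory.intervalIntegral_intervalIntegral_swap]
  · simp [h']
  · refine MeasureTheory.Integrable.mono_measure (ν := (MeasureTheory.volume.prod
      MeasureTheory.volume).restrict (Set.uIcc 0 (2 * Real.pi) ×ˢ Set.uIcc 0 (2 * Real.pi)))
      ?_ ?_
    · exact hF.continuousOn.integrableOn_compact (isCompact_uIcc.prod isCompact_uIcc)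
    · exact MeasureTheory.Measure.restrict_mono
        (Set.prod_mono Set.uIoc_subset_uIcc Set.uIoc_subset_uIcc) le_rfl

/-- A fourfold iterated integral vanishes if the integral over the outermost variable does. -/
theorem cint_four_eq_zero {ρ₁ ρ₂ ρ₃ ρ₄ : ℝ} (h₁ : ρ₁ ≠ 0) (h₂ : ρ₂ ≠ 0) (h₃ : ρ₃ ≠ 0)
    (h₄ : ρ₄ ≠ 0) {F : ℂ → ℂ → ℂ → ℂ → ℂ}
    (hF : Continuous fun p : ℝ × ℝ × ℝ × ℝ => F (circleMap 0 ρ₁ p.1) (circleMap 0 ρ₂ p.2.1)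
      (circleMap 0 ρ₃ p.2.2.1) (circleMap 0 ρ₄ p.2.2.2))
    (h : ∀ t₂ t₃ t₄, cint ρ₁ (fun z => F z (circleMap 0 ρ₂ t₂) (circleMap 0 ρ₃ t₃)
      (circleMap 0 ρ₄ t₄)) = 0) :
    cint ρ₁ (fun z₁ => cint ρ₂ fun z₂ => cint ρ₃ fun z₃ => cint ρ₄ fun z₄ => F z₁ z₂ z₃ z₄) = 0 := by
  refine cint_cint_eq_zero h₁ h₂ ?_ fun t₂ => ?_
  · refine continuous_cint h₃ (continuous_cint h₄ ?_)
    exact hF.comp (f := fun p : ((ℝ × ℝ) × ℝ) × ℝ => (p.1.1.1, p.1.1.2, p.1.2, p.2)) (by fun_prop)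
  refine cint_cint_eq_zero h₁ h₃ ?_ fun t₃ => ?_
  · refine continuous_cint h₄ ?_
    exact hF.comp (f := fun p : (ℝ × ℝ) × ℝ => (p.1.1, t₂, p.1.2, p.2)) (by fun_prop)
  refine cint_cint_eq_zero h₁ h₄ ?_ fun t₄ => h t₂ t₃ t₄
  exact hF.comp (f := fun p : ℝ × ℝ => (p.1, t₂, t₃, p.2)) (by fun_prop)

theorem cint_id_mul_eq_zero {ρ : ℝ} (hρ : 0 < ρ) {f : ℂ → ℂ}
    (hf : DifferentiableOn ℂ f (closedBall 0 ρ)) : cint ρ (fun z => z * f z) = 0 := by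
  unfold cint
  rw [circleIntegral.integral_congr (g := f) hρ.le fun z hz =>
    mul_div_cancel_left₀ _ (ne_of_mem_sphere hz hρ.ne'),
    DiffContOnCl.circleIntegral_eq_zero hρ.le (hf.diffContOnCl_ball subset_rfl), mul_zero]

theorem cint_zpow_eq_zero {ρ : ℝ} (hρ : 0 < ρ) {n : ℤ} (hn : n ≠ 0) :
    cint ρ (fun z => z ^ n) = 0 := by
  unfold cint
  rw [circleIntegral.integral_congr (g := fun z => (z - 0) ^ (n - 1)) hρ.le fun z hz => ?_,
    circleIntegral.integral_sub_zpow_of_ne (by omega), mul_zero]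
  have hz : z ≠ 0 := ne_of_mem_sphere hz hρ.ne'
  simp only [sub_zero, zpow_sub_one₀ hz, div_eq_mul_inv]

/-- Only negative powers of `z` occur in `z ^ p * (z⁻¹ - z + a) ^ k` if `p + k < 0`. -/
theorem cint_zpow_mul_pow_eq_zero {ρ : ℝ} (hρ : 0 < ρ) (a : ℂ) (k : ℕ) {p : ℤ} (hp : p + k < 0) :
    cint ρ (fun z => z ^ p * (z⁻¹ - z + a) ^ k) = 0 := by
  induction k generalizing p with
  | zero => simpa using cint_zpow_eq_zero hρ (n := p) (by simp at hp; omega)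
  | succ k ih =>
    push_cast at hp
    have h0 : ∀ z ∈ sphere (0 : ℂ) ρ, z ≠ 0 := fun z hz => ne_of_mem_sphere hz hρ.ne'
    have hc : ∀ p : ℤ, ContinuousOn (fun z : ℂ => z ^ p * (z⁻¹ - z + a) ^ k) (sphere 0 ρ) :=
      fun p => (continuousOn_id.zpow₀ p fun z hz => .inl (h0 z hz)).mul
        (((continuousOn_id.inv₀ h0).sub continuousOn_id).add continuousOn_const |>.pow k)
    have : cint ρ (fun z => z ^ p * (z⁻¹ - z + a) ^ (k + 1)) =
        cint ρ (fun z => (z ^ (p - 1) * (z⁻¹ - z + a) ^ k +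
          (-1) * (z ^ (p + 1) * (z⁻¹ - z + a) ^ k)) + a * (z ^ p * (z⁻¹ - z + a) ^ k)) := by
      refine cint_congr hρ.le fun z hz => ?_
      have hz : z ≠ 0 := norm_pos_iff.1 (hz ▸ hρ)
      rw [zpow_sub_one₀ hz, zpow_add_one₀ hz]
      ring
    rw [this, cint_add_const_mul hρ ?_ (hc p), cint_add_const_mul hρ (hc (p - 1)) (hc (p + 1)),
      ih (by omega), ih (by omega), ih (by omega)]
    · simp
    · exact (hc _).add (continuousOn_const.mul (hc _))

end NormalizedCircleIntegral

section Kernel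

open Metric Complex

/-- The denominator `s(z) - s(w) - 2γ`, normalized to equal `1` at `z = 0`. -/
noncomputable def yangDen (γ z w : ℂ) : ℂ := 1 - z * (w⁻¹ - w + (z - 4 * I * γ))

theorem sfun_sub_sub {z w : ℂ} (hz : z ≠ 0) (hw : w ≠ 0) (γ : ℂ) :
    (sfun z - sfun w - 2 * γ) * (2 * I * z) = -yangDen γ z w := by
  unfold sfun yangDen
  field_simp
  ring

theorem yangDen_ne_zero {γ z w : ℂ} {t : ℝ} (ht : t < 1 / (4 + 4 * ‖γ‖)) (hz : ‖z‖ ≤ t)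
    (hw : ‖w‖ ≤ 1) (hzw : ‖z‖ ≤ t * ‖w‖) : yangDen γ z w ≠ 0 := by
  have hγ := norm_nonneg γ
  have hz0 := norm_nonneg z
  have ht1 : t * (4 + 4 * ‖γ‖) < 1 := by rwa [lt_div_iff₀ (by positivity)] at ht
  have ht2 : t ≤ 1 := by nlinarith
  have h1 : ‖z * (w⁻¹ - w + (z - 4 * I * γ))‖ < 1 := by
    have e : z * (w⁻¹ - w + (z - 4 * I * γ)) = z * w⁻¹ - z * w + (z * z - z * (4 * I * γ)) := by
      ring
    rw [e]
    have b1 : ‖z * w⁻¹‖ ≤ t := by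
      rw [norm_mul, norm_inv]
      exact mul_inv_le_of_le_mul₀ (norm_nonneg _) (hz0.trans hz) hzw
    have b2 : ‖z * w‖ ≤ t := by
      rw [norm_mul]
      nlinarith [norm_nonneg w]
    have b3 : ‖z * z‖ ≤ t := by
      rw [norm_mul]
      nlinarith
    have b4 : ‖z * (4 * I * γ)‖ ≤ t * (4 * ‖γ‖) := by
      simp only [norm_mul, norm_I, Complex.norm_ofNat, mul_one]
      gcongr
    have c1 := norm_sub_le (z * w⁻¹) (z * w)
    have c2 := norm_sub_le (z * z) (z * (4 * I * γ))
    have c3 := norm_add_le (z * w⁻¹ - z * w) (z * z - z * (4 * I * γ))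
    have hzt : 0 ≤ t := hz0.trans hz
    rcases hzt.eq_or_lt with h | h
    · have : z = 0 := norm_le_zero_iff.1 (h ▸ hz)
      simp [this]
    · nlinarith
  intro h
  rw [yangDen, sub_eq_zero] at h
  rw [← h] at h1
  simp at h1

theorem inv_sfun_sub_sub {γ z w : ℂ} (hz : z ≠ 0) (hw : w ≠ 0) (hD : yangDen γ z w ≠ 0) :
    sfun z - sfun w - 2 * γ ≠ 0 ∧
      2 * γ / (sfun z - sfun w - 2 * γ) = -4 * I * γ * (z / yangDen γ z w) := by
  have h := sfun_sub_sub hz hw γ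
  have h0 : sfun z - sfun w - 2 * γ ≠ 0 := by
    intro h'
    rw [h', zero_mul, zero_eq_neg] at h
    exact hD h
  refine ⟨h0, ?_⟩
  field_simp
  linear_combination (2 * γ) * h

theorem sfun_sub_div {γ z w : ℂ} (hz : z ≠ 0) (hw : w ≠ 0) (hD : yangDen γ z w ≠ 0) :
    (sfun z - sfun w) / (sfun z - sfun w - 2 * γ) = 1 + -4 * I * γ * (z / yangDen γ z w) := by
  obtain ⟨h0, h⟩ := inv_sfun_sub_sub hz hw hD
  rw [← h]
  field_simp
  ring

theorem Y4_sfun {γ z w : ℂ} (hz : z ≠ 0) (hw : w ≠ 0) (hD : yangDen γ z w ≠ 0) (j l : Fin 4)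
    (v : V4) (a : Fin 4 → Spin) :
    Y4 γ j l (sfun z - sfun w) v a =
      Pi4 j l v a + -4 * I * γ * (z / yangDen γ z w) * (Pi4 j l v a - v a) := by
  obtain ⟨h0, h⟩ := inv_sfun_sub_sub hz hw hD
  rw [← h, Y4]
  field_simp
  ring

theorem continuous_yangDen {X : Type*} [TopologicalSpace X] (γ : ℂ) {f g : X → ℂ}
    (hf : Continuous f) (hg : Continuous g) (h : ∀ x, g x ≠ 0) :
    Continuous fun x => yangDen γ (f x) (g x) := by
  unfold yangDen
  fun_prop (disch := assumption)

theorem differentiable_yangDen (γ w : ℂ) : Differentiable ℂ fun z => yangDen γ z w := by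
  unfold yangDen
  fun_prop

/-- Integrating out `w` turns the scattering factor times `w ^ p * z ^ q`, `p < q`, into `z` times
a function that is holomorphic in `z`. -/
theorem exists_cint_eq_mul_cint (γ : ℂ) {ρ σ : ℝ} (hρ : 0 < ρ) (hσ : 0 < σ)
    (hD : ∀ z w : ℂ, ‖z‖ ≤ ρ → ‖w‖ = σ → yangDen γ z w ≠ 0) {p q : ℤ} (hpq : p < q) :
    ∃ h : ℂ → ℂ → ℂ,
      (∀ z, ‖z‖ = ρ → cint σ (fun w => w ^ p * z ^ q * (1 + -4 * I * γ * (z / yangDen γ z w))) =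
        cint σ (fun w => z * h z w)) ∧
      (Continuous fun x : ℝ × ℝ => h (circleMap 0 ρ x.1) (circleMap 0 σ x.2)) ∧
      ∀ w, ‖w‖ = σ → DifferentiableOn ℂ (fun z => h z w) (closedBall 0 ρ) := by
  have hz0 : ∀ z : ℂ, ‖z‖ = ρ → z ≠ 0 := fun z hz => norm_pos_iff.1 (hz ▸ hρ)
  have hw0 : ∀ z : ℂ, ‖z‖ = σ → z ≠ 0 := fun z hz => norm_pos_iff.1 (hz ▸ hσ)
  have hnρ : ∀ t, ‖circleMap 0 ρ t‖ = ρ := fun t => by simp [abs_of_pos hρ]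
  have hnσ : ∀ t, ‖circleMap 0 σ t‖ = σ := fun t => by simp [abs_of_pos hσ]
  have hcσ := continuous_circleMap 0 σ
  have hcw : ∀ n : ℤ, Continuous fun x : ℝ × ℝ => circleMap 0 σ x.2 ^ n := fun n =>
    (hcσ.comp continuous_snd).zpow₀ n fun x => .inl (hw0 _ (hnσ _))
  have hcD : Continuous fun x : ℝ × ℝ => yangDen γ (circleMap 0 ρ x.1) (circleMap 0 σ x.2) :=
    continuous_yangDen γ (by fun_prop) (by fun_prop) fun x => hw0 _ (hnσ _)
  have hD1 : ∀ x : ℝ × ℝ, yangDen γ (circleMap 0 ρ x.1) (circleMap 0 σ x.2) ≠ 0 :=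
    fun x => hD _ _ (hnρ _).le (hnσ _)
  have hdD : ∀ w, DifferentiableOn ℂ (fun z => yangDen γ z w) (closedBall 0 ρ) :=
    fun w => (differentiable_yangDen γ w).differentiableOn
  have hD2 : ∀ w, ‖w‖ = σ → ∀ z ∈ closedBall (0 : ℂ) ρ, yangDen γ z w ≠ 0 :=
    fun w hw z hz => hD z w (by simpa using hz) hw
  rcases lt_or_ge 0 q with hq | hq
  · obtain ⟨m, rfl⟩ : ∃ m : ℕ, q = m + 1 := ⟨(q - 1).toNat, by omega⟩
    refine ⟨fun z w => w ^ p * z ^ m * (1 + -4 * I * γ * (z / yangDen γ z w)), ?_, ?_, ?_⟩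
    · intro z hz
      congr 1
      ext w
      rw [zpow_add_one₀ (hz0 z hz), zpow_natCast]
      ring
    · have := hcw p
      fun_prop (disch := assumption)
    · intro w hw
      have := hdD w
      have := hD2 w hw
      fun_prop (disch := assumption)
  · obtain ⟨m, rfl⟩ : ∃ m : ℕ, q = -m := ⟨(-q).toNat, by omega⟩
    refine ⟨fun z w => w ^ p * (-4 * I * γ) *
      ((w⁻¹ - w + (z - 4 * I * γ)) ^ m / yangDen γ z w), ?_, ?_, ?_⟩
    · intro z hz
      have hz' := hz0 z hz
      set v : ℂ → ℂ := fun w => w⁻¹ - w + (z - 4 * I * γ)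
      have hs0 : ∀ w ∈ sphere (0 : ℂ) σ, w ≠ 0 := fun w hw => ne_of_mem_sphere hw hσ.ne'
      have hvc : ContinuousOn v (sphere 0 σ) :=
        ((continuousOn_id.inv₀ hs0).sub continuousOn_id).add continuousOn_const
      have hpc : ContinuousOn (fun w : ℂ => w ^ p) (sphere 0 σ) :=
        continuousOn_id.zpow₀ p fun w hw => .inl (hs0 w hw)
      have hsplit : ∀ n : ℕ, n ≤ m →
          cint σ (fun w => w ^ p * z ^ (-m : ℤ) * (1 + -4 * I * γ * (z / yangDen γ z w))) =
          cint σ (fun w => w ^ p * z ^ (-m : ℤ) * (-4 * I * γ) *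
            (z * (z * v w) ^ n / yangDen γ z w)) := by
        have hvn : ∀ n : ℕ, n ≤ m → cint σ (fun w => w ^ p * v w ^ n) = 0 := fun n hn =>
          cint_zpow_mul_pow_eq_zero hσ _ n (by omega)
        have hpv : ∀ n : ℕ, ContinuousOn (fun w => w ^ p * v w ^ n) (sphere 0 σ) :=
          fun n => hpc.mul (hvc.pow n)
        have hDs : ∀ w ∈ sphere (0 : ℂ) σ, yangDen γ z w ≠ 0 :=
          fun w hw => hD z w hz.le (by simpa using hw)
        have hDc : ContinuousOn (fun w => yangDen γ z w) (sphere 0 σ) :=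
          continuousOn_const.sub (continuousOn_const.mul hvc)
        have hrem : ∀ n : ℕ, ContinuousOn (fun w => w ^ p * z ^ (-m : ℤ) * (-4 * I * γ) *
            (z * (z * v w) ^ n / yangDen γ z w)) (sphere 0 σ) := fun n => by
          fun_prop (disch := assumption)
        intro n hn
        induction n with
        | zero =>
          rw [cint_congr hσ.le (g := fun w => w ^ p * z ^ (-m : ℤ) * (-4 * I * γ) *
            (z * (z * v w) ^ 0 / yangDen γ z w) + z ^ (-m : ℤ) * (w ^ p * v w ^ 0))
            fun w _ => by ring_nf, cint_add_const_mul hσ (hrem 0) (hpv 0), hvn 0 hn, mul_zero,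
            add_zero]
        | succ n ih =>
          rw [ih (by omega), cint_congr hσ.le (g := fun w => w ^ p * z ^ (-m : ℤ) *
            (-4 * I * γ) * (z * (z * v w) ^ (n + 1) / yangDen γ z w) +
            z ^ (-m : ℤ) * (-4 * I * γ) * z * z ^ n * (w ^ p * v w ^ n)) fun w hw => ?_,
            cint_add_const_mul hσ (hrem (n + 1)) (hpv n), hvn n (by omega), mul_zero, add_zero]
          have h1 : yangDen γ z w ≠ 0 := hD z w hz.le hw
          have h2 : yangDen γ z w = 1 - z * v w := rfl
          have h3 : z * (z * v w) ^ n / yangDen γ z w =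
              z * (z * v w) ^ (n + 1) / yangDen γ z w + z * (z * v w) ^ n := by
            rw [div_add' _ _ _ h1, div_left_inj' h1, h2]
            ring
          rw [h3]
          ring_nf
      rw [hsplit m le_rfl]
      congr 1
      ext w
      change _ = z * (w ^ p * (-4 * I * γ) * (v w ^ m / yangDen γ z w))
      rw [mul_pow, zpow_neg, zpow_natCast]
      field_simp
    · have := hcw p
      have h1 : Continuous fun x : ℝ × ℝ => (circleMap 0 σ x.2)⁻¹ :=
        Continuous.inv₀ (by fun_prop) fun x => hw0 _ (hnσ _)
      fun_prop (disch := assumption)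
    · intro w hw
      have := hdD w
      have := hD2 w hw
      fun_prop (disch := assumption)

end Kernel

/-- The contribution `T(1,3,2,4)|_{t=0}` vanishes: the quadruple contour integral with the
single Yang operator `Y_{2,3}(s(z1)-s(z4))` applied to `I4` is zero. -/
theorem T1324_vanishes (γ : ℂ) :
    ∃ r0 ∈ Set.Ioo (0 : ℝ) 1, ∀ r ∈ Set.Ioo (0 : ℝ) r0,
      ∀ (y1 y2 x1 x2 x3 x4 : ℤ), y1 < y2 → x1 ≤ x2 → x2 ≤ x3 → x3 ≤ x4 → x1 < x3 →
      ∀ a : Fin 4 → Spin,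
        (cint (r ^ 3) fun z1 => cint (r ^ 2) fun z2 => cint r fun z3 => cint 1 fun z4 =>
          Y4 γ 1 2 (sfun z1 - sfun z4) I4 a *
            ((sfun z1 - sfun z2) / (sfun z1 - sfun z2 - 2 * γ)) *
            ((sfun z3 - sfun z4) / (sfun z3 - sfun z4 - 2 * γ)) *
            (z2 ^ (x1 - y1) * z4 ^ (x2 - y2) * z1 ^ (x3 - y1) * z3 ^ (x4 - y2))) = 0 := by
  have hr₀ : 0 < 4 + 4 * ‖γ‖ := by positivity
  refine ⟨1 / (4 + 4 * ‖γ‖), ⟨by positivity, ?_⟩, ?_⟩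
  · rw [div_lt_one hr₀]
    linarith [norm_nonneg γ]
  rintro r ⟨hr, hrγ⟩ y1 y2 x1 x2 x3 x4 - - - - hx a
  have hr1 : r ≤ 1 := by
    refine hrγ.le.trans ((div_le_one hr₀).2 ?_)
    linarith [norm_nonneg γ]
  have hr2 : r ^ 2 ≤ 1 := pow_le_one₀ hr.le hr1
  have hr3 : r ^ 3 ≤ r := pow_le_of_le_one hr.le hr1 (by norm_num)
  have hD₁₂ : ∀ z w : ℂ, ‖z‖ ≤ r ^ 3 → ‖w‖ = r ^ 2 → yangDen γ z w ≠ 0 := fun z w hz hw =>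
    yangDen_ne_zero hrγ (hz.trans hr3) (hw.trans_le hr2) (by rw [hw]; linarith)
  have hD₁ : ∀ z w : ℂ, ‖z‖ ≤ r → ‖w‖ = 1 → yangDen γ z w ≠ 0 := fun z w hz hw =>
    yangDen_ne_zero hrγ hz hw.le (by simpa [hw] using hz)
  have h0 : ∀ {ρ : ℝ}, 0 < ρ → ∀ {z : ℂ}, ‖z‖ = ρ → z ≠ 0 := fun hρ z hz =>
    norm_pos_iff.1 (hz ▸ hρ)
  have hn : ∀ {ρ : ℝ}, 0 < ρ → ∀ t, ‖circleMap 0 ρ t‖ = ρ := fun hρ t => by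
    simp [abs_of_pos hρ]
  obtain ⟨h, hA, hhc, hhd⟩ := exists_cint_eq_mul_cint γ (pow_pos hr 3) (pow_pos hr 2) hD₁₂
    (show x1 - y1 < x3 - y1 by omega)
  set P : ℂ := Pi4 1 2 I4 a
  set Q : ℂ := I4 a
  set B : ℂ → ℂ → ℂ → ℂ := fun z1 z3 z4 =>
    (P + -4 * Complex.I * γ * (z1 / yangDen γ z1 z4) * (P - Q)) *
      (1 + -4 * Complex.I * γ * (z3 / yangDen γ z3 z4)) *
      (z4 ^ (x2 - y2) * z3 ^ (x4 - y2)) with hB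
  trans cint (r ^ 3) fun z1 => cint (r ^ 2) fun z2 => cint r fun z3 => cint 1 fun z4 =>
    z1 * h z1 z2 * B z1 z3 z4
  · refine cint_congr (pow_pos hr 3).le fun z1 hz1 => ?_
    simp only [cint_const_mul, cint_mul_const]
    rw [← cint_const_mul (r ^ 2) (h z1) z1, ← hA z1 hz1, ← cint_mul_const]
    refine cint_congr (pow_pos hr 2).le fun z2 hz2 => ?_
    simp only [← cint_const_mul]
    refine cint_congr hr.le fun z3 hz3 => cint_congr zero_le_one fun z4 hz4 => ?_
    have hz1' := h0 (pow_pos hr 3) hz1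
    have hz2' := h0 (pow_pos hr 2) hz2
    have hz3' := h0 hr hz3
    have hz4' := h0 one_pos hz4
    rw [Y4_sfun hz1' hz4' (hD₁ _ _ (hz1.trans_le hr3) hz4),
      sfun_sub_div hz1' hz2' (hD₁₂ _ _ hz1.le hz2), sfun_sub_div hz3' hz4' (hD₁ _ _ hz3.le hz4)]
    ring
  · refine cint_four_eq_zero (pow_pos hr 3).ne' (pow_pos hr 2).ne' hr.ne' one_ne_zero
      (F := fun z1 z2 z3 z4 => z1 * h z1 z2 * B z1 z3 z4) ?_ fun t₂ t₃ t₄ => ?_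
    · have hh : Continuous fun p : ℝ × ℝ × ℝ × ℝ =>
          h (circleMap 0 (r ^ 3) p.1) (circleMap 0 (r ^ 2) p.2.1) :=
        hhc.comp (f := fun p : ℝ × ℝ × ℝ × ℝ => (p.1, p.2.1)) (by fun_prop)
      have hD₁₄c : Continuous fun p : ℝ × ℝ × ℝ × ℝ =>
          yangDen γ (circleMap 0 (r ^ 3) p.1) (circleMap 0 1 p.2.2.2) :=
        continuous_yangDen γ (by fun_prop) (by fun_prop) fun p => h0 one_pos (hn one_pos _)
      have hD₃₄c : Continuous fun p : ℝ × ℝ × ℝ × ℝ =>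
          yangDen γ (circleMap 0 r p.2.2.1) (circleMap 0 1 p.2.2.2) :=
        continuous_yangDen γ (by fun_prop) (by fun_prop) fun p => h0 one_pos (hn one_pos _)
      have hD₁₄ : ∀ p : ℝ × ℝ × ℝ × ℝ,
          yangDen γ (circleMap 0 (r ^ 3) p.1) (circleMap 0 1 p.2.2.2) ≠ 0 := fun p =>
        hD₁ _ _ ((hn (pow_pos hr 3) _).trans_le hr3) (hn one_pos _)
      have hD₃₄ : ∀ p : ℝ × ℝ × ℝ × ℝ,
          yangDen γ (circleMap 0 r p.2.2.1) (circleMap 0 1 p.2.2.2) ≠ 0 := fun p =>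
        hD₁ _ _ (hn hr _).le (hn one_pos _)
      have hz4 : Continuous fun p : ℝ × ℝ × ℝ × ℝ => circleMap 0 1 p.2.2.2 ^ (x2 - y2) :=
        Continuous.zpow₀ (by fun_prop) _ fun p => .inl (h0 one_pos (hn one_pos _))
      have hz3 : Continuous fun p : ℝ × ℝ × ℝ × ℝ => circleMap 0 r p.2.2.1 ^ (x4 - y2) :=
        Continuous.zpow₀ (by fun_prop) _ fun p => .inl (h0 hr (hn hr _))
      have hc₁ : Continuous fun p : ℝ × ℝ × ℝ × ℝ => circleMap 0 (r ^ 3) p.1 := by fun_prop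
      have hc₃ : Continuous fun p : ℝ × ℝ × ℝ × ℝ => circleMap 0 r p.2.2.1 := by fun_prop
      exact (hc₁.mul hh).mul (((continuous_const.add ((continuous_const.mul
        (hc₁.div hD₁₄c hD₁₄)).mul continuous_const)).mul (continuous_const.add
        (continuous_const.mul (hc₃.div hD₃₄c hD₃₄)))).mul (hz4.mul hz3))
    · simp only [mul_assoc]
      refine cint_id_mul_eq_zero (pow_pos hr 3) ((hhd _ (hn (pow_pos hr 2) _)).mul ?_)
      have hd := (differentiable_yangDen γ (circleMap 0 1 t₄)).differentiableOn
        (s := Metric.closedBall 0 (r ^ 3))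
      have hne : ∀ z ∈ Metric.closedBall (0 : ℂ) (r ^ 3), yangDen γ z (circleMap 0 1 t₄) ≠ 0 :=
        fun z hz => hD₁ _ _ ((mem_closedBall_zero_iff.1 hz).trans hr3) (hn one_pos _)
      simp only [hB]
      fun_prop (disch := assumption)
end
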